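/- arXiv:2504.02771 — 17 statements merged into one kernel-verified Lean document; each statement's English description precedes it below -/
import Mathlib

section
/- Let H be a finite group of order 12. If H is generated by two elements of order 3, then H is isomorphic to the alternating group A4 on four letters. -/
theorem stmt_1 (H : Type*) [Group H] [Fintype H] (hcard : Fintype.card H = 12)
    (hgen : ∃ x y : H, orderOf x = 3 ∧ orderOf y = 3 ∧
      Subgroup.closure ({x, y} : Set H) = ⊤) :
    Nonempty (H ≃* alternatingGroup (Fin 4)) := by
  obtain ⟨x, y, hx, hy, hxy⟩ := hgen
  have hH : Nat.card H = 12 := by rw [Nat.card_eq_fintype_card, hcard]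
  obtain ⟨K, hK⟩ : ∃ K, K = Subgroup.zpowers x := ⟨_, rfl⟩
  have hKc : Nat.card K = 3 := by rw [hK, Nat.card_zpowers, hx]
  have hKi : K.index = 4 := by
    have := K.card_mul_index
    rw [hKc, hH] at this
    omega
  have hxK : x ∈ K := by rw [hK]; exact Subgroup.mem_zpowers x
  -- `K` is not normal
  have hnn : ¬ K.Normal := by
    intro hn
    have hq : Nat.card (H ⧸ K) = 4 := hKi
    have h4 : (QuotientGroup.mk y : H ⧸ K) ^ 4 = 1 := by
      rw [← hq]; exact pow_card_eq_one'
    have h3 : (QuotientGroup.mk y : H ⧸ K) ^ 3 = 1 := by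
      rw [← QuotientGroup.mk_pow, ← hy, pow_orderOf_eq_one, QuotientGroup.mk_one]
    have h1 : (QuotientGroup.mk y : H ⧸ K) = 1 := by
      rwa [pow_succ, h3, one_mul] at h4
    have hyK : y ∈ K := (QuotientGroup.eq_one_iff y).1 h1
    have htop : K = ⊤ := by
      rw [eq_top_iff, ← hxy, Subgroup.closure_le]
      rintro z (rfl | rfl)
      · exact hxK
      · exact hyK
    rw [htop, Subgroup.index_top] at hKi
    omega
  have hcore : K.normalCore = ⊥ := by
    have hd := Subgroup.card_dvd_of_le K.normalCore_le
    rw [hKc] at hd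
    rcases (Nat.dvd_prime Nat.prime_three).1 hd with h | h
    · exact Subgroup.card_eq_one.1 h
    · have := Subgroup.eq_of_le_of_card_ge K.normalCore_le (by rw [h, hKc])
      exact absurd (this ▸ K.normalCore_normal) hnn
  have hinj : Function.Injective (MulAction.toPermHom H (H ⧸ K)) := by
    rw [← MonoidHom.ker_eq_bot_iff, ← Subgroup.normalCore_eq_ker, hcore]
  have e : (H ⧸ K) ≃ Fin 4 := Finite.equivFinOfCardEq hKi
  let f : H →* Equiv.Perm (Fin 4) :=
    (e.permCongrHom : _ →* Equiv.Perm (Fin 4)).comp (MulAction.toPermHom H (H ⧸ K))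
  have hf : Function.Injective f := e.permCongrHom.injective.comp hinj
  have hr : f.range.index = 2 := by
    have h1 := f.range.card_mul_index
    have h2 : Nat.card f.range = 12 := by
      rw [← hH]; exact (Nat.card_congr (MonoidHom.ofInjective hf).toEquiv).symm
    rw [h2, Nat.card_perm, Nat.card_fin] at h1
    simp [Nat.factorial] at h1
    omega
  have ha := Equiv.Perm.eq_alternatingGroup_of_index_eq_two hr
  exact ⟨(MonoidHom.ofInjective hf).trans (MulEquiv.subgroupCongr ha)⟩
end

section
/- Let p ≥ 7 be a prime number. If m1 ≤ m2 ≤ m3 are integers, each at least 2, each dividing 8p, and satisfying 1/m1 + 1/m2 + 1/m3 = 1/2 + 3/(4p) (as rational numbers), then (m1, m2, m3) = (2, 2p, 4p). -/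
theorem dvd_eight_cases (k : ℕ) (h : k ∣ 8) : k = 1 ∨ k = 2 ∨ k = 4 ∨ k = 8 := by
  have hk : k ≤ 8 := Nat.le_of_dvd (by norm_num) h
  interval_cases k <;> omega

theorem codivisor_cases (p : ℕ) (hp : p.Prime) (m : ℤ) (hm : 2 ≤ m) (d : m ∣ 8 * p) :
    ∃ k : ℕ, m * k = 8 * p ∧
      (k = 1 ∨ k = 2 ∨ k = 4 ∨ k = 8 ∨ k = p ∨ k = 2 * p ∨ k = 4 * p) := by
  have hpos := hp.pos
  lift m to ℕ using by omega
  have d' : m ∣ 8 * p := by exact_mod_cast d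
  obtain ⟨k, hk⟩ := d'
  refine ⟨k, by exact_mod_cast hk.symm, ?_⟩
  have hkd : k ∣ 8 * p := ⟨m, by rw [hk, mul_comm]⟩
  rcases Nat.coprime_or_dvd_of_prime hp k with hc | hd
  · have := dvd_eight_cases k (hc.symm.dvd_of_dvd_mul_right hkd)
    omega
  · obtain ⟨j, rfl⟩ := hd
    have hmj : 8 = m * j := by
      apply Nat.eq_of_mul_eq_mul_right hpos
      rw [hk]; ring
    have hj : j ∣ 8 := ⟨m, by rw [hmj, mul_comm]⟩
    rcases dvd_eight_cases j hj with rfl | rfl | rfl | rfl <;> omega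

theorem stmt_2 (p : ℕ) (hp : p.Prime) (hp7 : 7 ≤ p)
    (m1 m2 m3 : ℤ) (h12 : m1 ≤ m2) (h23 : m2 ≤ m3)
    (h1 : 2 ≤ m1) (h2 : 2 ≤ m2) (h3 : 2 ≤ m3)
    (d1 : m1 ∣ 8 * p) (d2 : m2 ∣ 8 * p) (d3 : m3 ∣ 8 * p)
    (heq : (1 : ℚ) / m1 + 1 / m2 + 1 / m3 = 1 / 2 + 3 / (4 * p)) :
    m1 = 2 ∧ m2 = 2 * p ∧ m3 = 4 * p := by
  obtain ⟨k1, e1, c1⟩ := codivisor_cases p hp m1 h1 d1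
  obtain ⟨k2, e2, c2⟩ := codivisor_cases p hp m2 h2 d2
  obtain ⟨k3, e3, c3⟩ := codivisor_cases p hp m3 h3 d3
  have hp0 : (p : ℚ) ≠ 0 := by exact_mod_cast hp.ne_zero
  have key : ∀ (m : ℤ) (k : ℕ), 2 ≤ m → m * k = 8 * p → (1 : ℚ) / m = k / (8 * p) := by
    intro m k hm e
    have hm0 : (m : ℚ) ≠ 0 := by
      have : m ≠ 0 := by omega
      exact_mod_cast this
    have e' : (m : ℚ) * k = 8 * p := by exact_mod_cast e
    rw [div_eq_div_iff hm0 (by positivity)]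
    linarith
  rw [key m1 k1 h1 e1, key m2 k2 h2 e2, key m3 k3 h3 e3] at heq
  field_simp at heq
  have hs : k1 + k2 + k3 = 4 * p + 6 := by
    have : (k1 : ℚ) + k2 + k3 = 4 * p + 6 := by linarith
    exact_mod_cast this
  have o12 : k2 ≤ k1 := by
    by_contra! h
    have : (k1 : ℤ) < k2 := by exact_mod_cast h
    nlinarith
  have o23 : k3 ≤ k2 := by
    by_contra! h
    have : (k2 : ℤ) < k3 := by exact_mod_cast h
    nlinarith
  have hk1 : k1 = 4 * p := by omega
  have hk2 : k2 = 4 := by omega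
  have hk3 : k3 = 2 := by omega
  subst hk1 hk2 hk3
  push_cast at e1 e2 e3
  refine ⟨?_, by omega, by omega⟩
  have hpz : (4 * p : ℤ) ≠ 0 := by have := hp.pos; omega
  apply mul_right_cancel₀ hpz
  linarith
end

section
/- Let p ≥ 7 be a prime number. If m1 ≤ m2 ≤ m3 are integers, each at least 2, each dividing 12p, and satisfying 1/m1 + 1/m2 + 1/m3 = 2/3 + 1/(2p) (as rational numbers), then (m1, m2, m3) = (2, 6, 2p) or (m1, m2, m3) = (3, 3, 2p). -/
theorem dvd_aux (p : ℕ) (hp : p.Prime) (m : ℤ) (h : 2 ≤ m) (d : m ∣ 12 * p) :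
    (m ∣ 12 ∧ m ≤ 12) ∨ ∃ k : ℤ, m = p * k ∧ 1 ≤ k ∧ k ≤ 12 := by
  have hpp : Prime (p : ℤ) := Nat.prime_iff_prime_int.mp hp
  have hp0 : (0 : ℤ) < p := by exact_mod_cast hp.pos
  by_cases hd : (p : ℤ) ∣ m
  · right
    obtain ⟨k, rfl⟩ := hd
    refine ⟨k, rfl, ?_, ?_⟩
    · by_contra hk
      nlinarith
    · rw [mul_comm (12 : ℤ)] at d
      exact Int.le_of_dvd (by norm_num) (Int.dvd_of_mul_dvd_mul_left hp0.ne' d)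
  · left
    have hc : IsCoprime m (p : ℤ) := ((Prime.coprime_iff_not_dvd hpp).mpr hd).symm
    have := hc.dvd_of_dvd_mul_right d
    exact ⟨this, Int.le_of_dvd (by norm_num) this⟩

theorem stmt_3 (p : ℕ) (hp : p.Prime) (hp7 : 7 ≤ p)
    (m1 m2 m3 : ℤ) (h12 : m1 ≤ m2) (h23 : m2 ≤ m3)
    (h1 : 2 ≤ m1) (h2 : 2 ≤ m2) (h3 : 2 ≤ m3)
    (d1 : m1 ∣ 12 * p) (d2 : m2 ∣ 12 * p) (d3 : m3 ∣ 12 * p)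
    (heq : (1 : ℚ) / m1 + 1 / m2 + 1 / m3 = 2 / 3 + 1 / (2 * p)) :
    (m1 = 2 ∧ m2 = 6 ∧ m3 = 2 * p) ∨ (m1 = 3 ∧ m2 = 3 ∧ m3 = 2 * p) := by
  have q1 : (2 : ℚ) ≤ m1 := by exact_mod_cast h1
  have q12 : (m1 : ℚ) ≤ m2 := by exact_mod_cast h12
  have q23 : (m2 : ℚ) ≤ m3 := by exact_mod_cast h23
  have qp : (7 : ℚ) ≤ p := by exact_mod_cast hp7
  have i12 : (1 : ℚ) / m2 ≤ 1 / m1 := one_div_le_one_div_of_le (by linarith) q12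
  have i23 : (1 : ℚ) / m3 ≤ 1 / m2 := one_div_le_one_div_of_le (by linarith) q23
  have i1 : (1 : ℚ) / m1 ≤ 1 / 2 := one_div_le_one_div_of_le (by linarith) q1
  have ip : (0 : ℚ) < 1 / (2 * p) := by positivity
  have b1 : m1 ≤ 4 := by
    by_contra hc
    have : (5 : ℚ) ≤ m1 := by exact_mod_cast (by omega : (5 : ℤ) ≤ m1)
    have : (1 : ℚ) / m1 ≤ 1 / 5 := one_div_le_one_div_of_le (by norm_num) this
    linarith
  have b2 : m2 ≤ 11 := by
    by_contra hc
    have : (12 : ℚ) ≤ m2 := by exact_mod_cast (by omega : (12 : ℤ) ≤ m2)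
    have : (1 : ℚ) / m2 ≤ 1 / 12 := one_div_le_one_div_of_le (by norm_num) this
    linarith
  have E : 6 * (p : ℤ) * (m2 * m3 + m1 * m3 + m1 * m2) = (4 * p + 3) * (m1 * m2 * m3) := by
    have n1 : (m1 : ℚ) ≠ 0 := by linarith
    have n2 : (m2 : ℚ) ≠ 0 := by linarith
    have n3 : (m3 : ℚ) ≠ 0 := by linarith
    have n4 : (p : ℚ) ≠ 0 := by linarith
    field_simp at heq
    have : 6 * (p : ℚ) * (m2 * m3 + m1 * m3 + m1 * m2) = (4 * p + 3) * (m1 * m2 * m3) := by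
      linarith
    exact_mod_cast this
  clear heq i12 i23 i1 ip q1 q12 q23 qp d1
  have hpz : (7 : ℤ) ≤ p := by exact_mod_cast hp7
  have c2 : (m2 ∣ 12) ∨ m2 = p := by
    rcases dvd_aux p hp m2 h2 d2 with h | ⟨k, hk, hk1, hk2⟩
    · exact Or.inl h.1
    · right
      have : k = 1 := by nlinarith
      rw [hk, this, mul_one]
  rcases dvd_aux p hp m3 h3 d3 with ⟨h, hb⟩ | ⟨k, rfl, hk1, hk2⟩
  · clear d2 d3
    interval_cases m1 <;> interval_cases m2 <;> first | omega | (interval_cases m3 <;> omega)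
  · have E2 : 6 * (m2 * (p * k) + m1 * (p * k) + m1 * m2) = (4 * (p : ℤ) + 3) * (m1 * m2 * k) := by
      have : (p : ℤ) ≠ 0 := by omega
      apply mul_left_cancel₀ this
      linarith
    have hp9 : p ≠ 9 := by
      rintro rfl
      norm_num at hp
    clear d2 d3 E
    interval_cases m1 <;> interval_cases m2 <;> first | omega | (interval_cases k <;> omega)
end

section
/- Let p ≥ 5 be a prime number. If m1 ≤ m2 ≤ m3 ≤ m4 are integers, each at least 2, each dividing 4p, and satisfying 1/m1 + 1/m2 + 1/m3 + 1/m4 = 1 + 3/(2p) (as rational numbers), then either (m1, m2, m3, m4) = (2, 2, p, 2p), or p = 5 and (m1, m2, m3, m4) = (2, 2, 4, 20). -/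
lemma aux_div (p : ℕ) (hp : p.Prime) (hp5 : 5 ≤ p) (m : ℤ) (h : 2 ≤ m) (d : m ∣ 4 * p) :
    ∃ k : ℤ, (1 : ℚ) / m = k / (4 * p) ∧
      ((m = 2 ∧ k = 2 * p) ∨ (m = 4 ∧ k = p) ∨ (m = p ∧ k = 4) ∨ (m = 2 * p ∧ k = 2) ∨
        (m = 4 * p ∧ k = 1)) := by
  have hp0 : (p : ℚ) ≠ 0 := by exact_mod_cast hp.ne_zero
  have key : m = 2 ∨ m = 4 ∨ m = p ∨ m = 2 * p ∨ m = 4 * p := by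
    lift m to ℕ using by omega
    have d' : m ∣ 4 * p := by exact_mod_cast d
    obtain ⟨a, b, ha, hb, rfl⟩ := (Nat.dvd_mul).1 d'
    have ha4 : a ≤ 4 := Nat.le_of_dvd (by norm_num) ha
    rcases (Nat.dvd_prime hp).1 hb with rfl | rfl
    · interval_cases a <;> simp_all
    · interval_cases a <;> simp_all
  rcases key with rfl | rfl | rfl | rfl | rfl
  · exact ⟨2 * p, by push_cast; field_simp; norm_num, by simp⟩
  · exact ⟨p, by push_cast; field_simp, by simp⟩
  · exact ⟨4, by push_cast; field_simp, by simp⟩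
  · exact ⟨2, by push_cast; field_simp; norm_num, by simp⟩
  · exact ⟨1, by push_cast; field_simp, by simp⟩

theorem stmt_4 (p : ℕ) (hp : p.Prime) (hp5 : 5 ≤ p)
    (m1 m2 m3 m4 : ℤ) (h12 : m1 ≤ m2) (h23 : m2 ≤ m3) (h34 : m3 ≤ m4)
    (h1 : 2 ≤ m1) (h2 : 2 ≤ m2) (h3 : 2 ≤ m3) (h4 : 2 ≤ m4)
    (d1 : m1 ∣ 4 * p) (d2 : m2 ∣ 4 * p) (d3 : m3 ∣ 4 * p) (d4 : m4 ∣ 4 * p)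
    (heq : (1 : ℚ) / m1 + 1 / m2 + 1 / m3 + 1 / m4 = 1 + 3 / (2 * p)) :
    (m1 = 2 ∧ m2 = 2 ∧ m3 = p ∧ m4 = 2 * p) ∨
      (p = 5 ∧ m1 = 2 ∧ m2 = 2 ∧ m3 = 4 ∧ m4 = 20) := by
  have hp0 : (p : ℚ) ≠ 0 := by exact_mod_cast hp.ne_zero
  have hp6 : p ≠ 6 := by rintro rfl; revert hp; norm_num
  obtain ⟨k1, e1, c1⟩ := aux_div p hp hp5 m1 h1 d1
  obtain ⟨k2, e2, c2⟩ := aux_div p hp hp5 m2 h2 d2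
  obtain ⟨k3, e3, c3⟩ := aux_div p hp hp5 m3 h3 d3
  obtain ⟨k4, e4, c4⟩ := aux_div p hp hp5 m4 h4 d4
  rw [e1, e2, e3, e4] at heq
  have hs : (k1 : ℚ) + k2 + k3 + k4 = 4 * p + 6 := by
    field_simp at heq
    linarith
  have hs' : k1 + k2 + k3 + k4 = 4 * (p : ℤ) + 6 := by exact_mod_cast hs
  clear heq hs e1 e2 e3 e4 d1 d2 d3 d4 hp0 hp
  rcases c1 with ⟨rfl, rfl⟩ | ⟨rfl, rfl⟩ | ⟨rfl, rfl⟩ | ⟨rfl, rfl⟩ | ⟨rfl, rfl⟩ <;>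
  rcases c2 with ⟨rfl, rfl⟩ | ⟨rfl, rfl⟩ | ⟨rfl, rfl⟩ | ⟨rfl, rfl⟩ | ⟨rfl, rfl⟩ <;>
  first
  | omega
  | (rcases c3 with ⟨rfl, rfl⟩ | ⟨rfl, rfl⟩ | ⟨rfl, rfl⟩ | ⟨rfl, rfl⟩ | ⟨rfl, rfl⟩ <;>
     rcases c4 with ⟨rfl, rfl⟩ | ⟨rfl, rfl⟩ | ⟨rfl, rfl⟩ | ⟨rfl, rfl⟩ | ⟨rfl, rfl⟩ <;> omega)
end

section
/- Let p ≥ 5 be a prime number. If m1 ≤ m2 ≤ m3 are integers, each at least 2, each dividing 4p, and satisfying 1/m1 + 1/m2 + 1/m3 = 3/(2p) (as rational numbers), then (m1, m2, m3) = (2p, 2p, 2p) or (m1, m2, m3) = (p, 4p, 4p). -/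
theorem stmt_5 (p : ℕ) (hp : p.Prime) (hp5 : 5 ≤ p)
    (m1 m2 m3 : ℤ) (h12 : m1 ≤ m2) (h23 : m2 ≤ m3)
    (h1 : 2 ≤ m1) (h2 : 2 ≤ m2) (h3 : 2 ≤ m3)
    (d1 : m1 ∣ 4 * p) (d2 : m2 ∣ 4 * p) (d3 : m3 ∣ 4 * p)
    (heq : (1 : ℚ) / m1 + 1 / m2 + 1 / m3 = 3 / (2 * p)) :
    (m1 = 2 * p ∧ m2 = 2 * p ∧ m3 = 2 * p) ∨
      (m1 = p ∧ m2 = 4 * p ∧ m3 = 4 * p) := by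
  have hpz : (5 : ℤ) ≤ p := by exact_mod_cast hp5
  have hpq : (p : ℚ) ≠ 0 := by
    have := hp.ne_zero
    exact_mod_cast this
  have key : ∀ m k : ℤ, 2 ≤ m → 4 * (p : ℤ) = m * k → (1 : ℚ) / m = k / (4 * p) ∧ 1 ≤ k := by
    intro m k hm h
    have hmq : (m : ℚ) ≠ 0 := by
      have : m ≠ 0 := by omega
      exact_mod_cast this
    have hq : 4 * (p : ℚ) = m * k := by exact_mod_cast h
    constructor
    · rw [div_eq_div_iff hmq (by positivity)]
      linarith
    · by_contra hk
      nlinarith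
  have h3p : ¬ (3 ∣ p) := by
    intro h
    have := (Nat.prime_dvd_prime_iff_eq Nat.prime_three hp).1 h
    omega
  obtain ⟨k1, e1⟩ := d1
  obtain ⟨k2, e2⟩ := d2
  obtain ⟨k3, e3⟩ := d3
  obtain ⟨q1, l1⟩ := key m1 k1 h1 e1
  obtain ⟨q2, l2⟩ := key m2 k2 h2 e2
  obtain ⟨q3, l3⟩ := key m3 k3 h3 e3
  have hs : k1 + k2 + k3 = 6 := by
    rw [q1, q2, q3] at heq
    field_simp at heq
    have : (k1 : ℚ) + k2 + k3 = 6 := by linarith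
    exact_mod_cast this
  have u1 : k1 ≤ 4 := by omega
  have u2 : k2 ≤ 4 := by omega
  obtain rfl : k3 = 6 - k1 - k2 := by omega
  clear q1 q2 q3 heq key
  interval_cases k1 <;> interval_cases k2 <;> omega
end

section
/- Let p ≥ 5 be a prime number and let G be a finite group of order 8p. Suppose there exist elements x, y, z ∈ G with x·y·z = 1, orderOf x = 2, orderOf y = 2p, orderOf z = 4p, and such that {x, y, z} generates G. Then G is isomorphic to the direct product Z_p × D_4 of a cyclic group of order p and a dihedral group of order 8. -/
theorem exists_zmod_hom {G : Type*} [Group G] (n : ℕ) (g : G) (hg : g ^ n = 1) :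
    ∃ f : Multiplicative (ZMod n) →* G, ∀ k : ℤ, f (Multiplicative.ofAdd (k : ZMod n)) = g ^ k := by
  refine ⟨AddMonoidHom.toMultiplicativeLeft
    (ZMod.lift n ⟨zmultiplesHom (Additive G) (Additive.ofMul g), ?_⟩), ?_⟩
  · simp [← ofMul_pow, hg]
  · intro k
    simp [← ofMul_zpow]

theorem exists_dihedral_hom {G : Type*} [Group G] (n : ℕ) (g x : G) (hg : g ^ n = 1)
    (hx : x * x = 1) (hxg : x * g * x⁻¹ = g⁻¹) :
    ∃ f : DihedralGroup n →* G, (∀ k : ℤ, f (DihedralGroup.r (k : ZMod n)) = g ^ k) ∧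
      ∀ k : ℤ, f (DihedralGroup.sr (k : ZMod n)) = x * g ^ k := by
  obtain ⟨φ, hφ⟩ := exists_zmod_hom n g hg
  have key : ∀ k : ℤ, g ^ k * x = x * g ^ (-k) := by
    intro k
    have h1 : x * g ^ (-k) * x⁻¹ = g ^ k := by
      rw [← conj_zpow, hxg]; simp
    rw [← h1]; simp
  let F : DihedralGroup n → G := fun d => match d with
    | .r i => φ (Multiplicative.ofAdd i)
    | .sr i => x * φ (Multiplicative.ofAdd i)
  have Fr : ∀ k : ℤ, F (DihedralGroup.r (k : ZMod n)) = g ^ k := fun k => hφ k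
  have Fs : ∀ k : ℤ, F (DihedralGroup.sr (k : ZMod n)) = x * g ^ k := fun k => by
    rw [← hφ k]
  refine ⟨MonoidHom.mk' F ?_, Fr, Fs⟩
  rintro (i | i) (j | j) <;> obtain ⟨i, rfl⟩ := ZMod.intCast_surjective i <;>
    obtain ⟨j, rfl⟩ := ZMod.intCast_surjective j
  · rw [DihedralGroup.r_mul_r, ← Int.cast_add, Fr, Fr, Fr, zpow_add]
  · rw [DihedralGroup.r_mul_sr, ← Int.cast_sub, Fr, Fs, Fs, ← mul_assoc, key, mul_assoc,
      ← zpow_add, sub_eq_neg_add]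
  · rw [DihedralGroup.sr_mul_r, ← Int.cast_add, Fr, Fs, Fs, zpow_add, mul_assoc]
  · rw [DihedralGroup.sr_mul_sr, ← Int.cast_sub, Fr, Fs, Fs, mul_assoc, ← mul_assoc (g ^ i), key,
      mul_assoc x, ← mul_assoc, hx, one_mul, ← zpow_add, sub_eq_neg_add]

theorem stmt_6 (p : ℕ) (hp : p.Prime) (hp5 : 5 ≤ p)
    (G : Type*) [Group G] [Fintype G] (hcard : Fintype.card G = 8 * p)
    (h : ∃ x y z : G, x * y * z = 1 ∧ orderOf x = 2 ∧ orderOf y = 2 * p ∧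
      orderOf z = 4 * p ∧ Subgroup.closure ({x, y, z} : Set G) = ⊤) :
    Nonempty (G ≃* Multiplicative (ZMod p) × DihedralGroup 4) := by
  obtain ⟨x, y, z, hxyz, hox, hoy, hoz, hgen⟩ := h
  haveI : NeZero p := ⟨hp.ne_zero⟩
  have hx : x * x = 1 := by rw [← pow_two, ← hox, pow_orderOf_eq_one]
  have hxi : x⁻¹ = x := inv_eq_of_mul_eq_one_left hx
  have hy : y = (z * x)⁻¹ := by
    rw [mul_inv_rev]
    have : y = x⁻¹ * (x * y * z) * z⁻¹ := by group
    rw [this, hxyz]; simp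
  -- the subgroup generated by z is normal
  have hidx : (Subgroup.zpowers z).index = 2 := by
    have h1 := (Subgroup.zpowers z).card_mul_index
    rw [Nat.card_zpowers, hoz, Nat.card_eq_fintype_card, hcard] at h1
    have : 0 < p := hp.pos
    nlinarith
  have hN := Subgroup.normal_of_index_eq_two hidx
  obtain ⟨k, hk⟩ := Subgroup.mem_zpowers_iff.mp
    (hN.conj_mem z (Subgroup.mem_zpowers z) x)
  -- hk : z ^ k = x * z * x⁻¹
  have hconj : ∀ m : ℤ, x * z ^ m * x⁻¹ = z ^ (k * m) := by
    intro m; rw [← conj_zpow, ← hk, zpow_mul]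
  have hdvd : ∀ m : ℤ, z ^ m = 1 ↔ ((4 * p : ℤ) ∣ m) := by
    intro m; rw [← orderOf_dvd_iff_zpow_eq_one, hoz]; push_cast; rfl
  have hp0 : (p : ℤ) ≠ 0 := by exact_mod_cast hp.ne_zero
  have hw2 : (z * x) ^ 2 = z ^ (k + 1) := by
    have : (z * x) ^ 2 = z * (x * z * x) := by simp only [pow_two, mul_assoc]
    rw [this]
    nth_rw 2 [← hxi]
    rw [← hk, add_comm, zpow_add, zpow_one]
  have how : orderOf (z * x) = 2 * p := by rw [← hoy, hy, orderOf_inv]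
  have h4 : (4 : ℤ) ∣ k + 1 := by
    have h1 : (z * x) ^ (2 * p) = 1 := by rw [← how, pow_orderOf_eq_one]
    rw [pow_mul, hw2, ← zpow_natCast, ← zpow_mul, hdvd] at h1
    exact Int.dvd_of_mul_dvd_mul_right hp0 h1
  have hcop : IsCoprime (4 : ℤ) (p : ℤ) := by
    have : Nat.Coprime 4 p := by
      have : Nat.Coprime (2 ^ 2) p :=
        Nat.Coprime.pow_left 2 ((Nat.coprime_primes Nat.prime_two hp).mpr (by omega))
      simpa using this
    exact_mod_cast Nat.isCoprime_iff_coprime.mpr this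
  have hpk : (p : ℤ) ∣ k - 1 := by
    have h1 : z ^ (k * k - 1) = 1 := by
      have h2 := hconj k
      rw [hk, hxi] at h2
      have h3 : x * (x * z * x) * x = z := by
        have : x * (x * z * x) * x = (x * x) * z * (x * x) := by simp only [mul_assoc]
        rw [this, hx]; simp
      rw [h3] at h2
      rw [zpow_sub, ← h2]; simp
    rw [hdvd] at h1
    have h2 : (p : ℤ) ∣ (k - 1) * (k + 1) := by
      refine (Dvd.intro_left (4 : ℤ) rfl).trans (h1.trans (dvd_of_eq (by ring)))
    rcases (Nat.prime_iff_prime_int.mp hp).dvd_or_dvd h2 with h | h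
    · exact h
    · exfalso
      have h3 : (4 * p : ℤ) ∣ k + 1 := hcop.mul_dvd h4 h
      rw [← hdvd, ← hw2] at h3
      have := Nat.le_of_dvd (by norm_num) (orderOf_dvd_of_pow_eq_one h3)
      omega
  have hza : x * z ^ p * x⁻¹ = (z ^ p)⁻¹ := by
    rw [← zpow_natCast, hconj, ← zpow_neg, ← mul_inv_eq_one, ← zpow_neg, ← zpow_add, hdvd]
    obtain ⟨c, hc⟩ := h4
    exact ⟨c, by linear_combination (p : ℤ) * hc⟩
  have hzb : x * z ^ 4 * x⁻¹ = z ^ 4 := by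
    have := hconj 4
    have h4' : z ^ (4 : ℤ) = z ^ 4 := by norm_cast
    rw [h4'] at this
    rw [this, ← h4', ← mul_inv_eq_one, ← zpow_neg, ← zpow_add, hdvd]
    obtain ⟨c, hc⟩ := hpk
    exact ⟨c, by linear_combination 4 * hc⟩
  have hz4p : z ^ (4 * p) = 1 := by rw [← hoz, pow_orderOf_eq_one]
  obtain ⟨φ, hφ⟩ := exists_zmod_hom p (z ^ 4) (by rw [← pow_mul, hz4p])
  obtain ⟨ψ, hψr, hψs⟩ := exists_dihedral_hom 4 (z ^ p) x
    (by rw [← pow_mul, mul_comm, hz4p]) hx hza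
  have hcx : Commute (z ^ 4) x := by
    have : x * z ^ 4 = z ^ 4 * x := mul_inv_eq_iff_eq_mul.mp hzb
    exact this.symm
  have hcz : Commute (z ^ 4) (z ^ p) := Commute.pow_pow_self z 4 p
  have hcomm : ∀ m n, Commute (φ m) (ψ n) := by
    intro m n
    obtain ⟨i, hi⟩ := ZMod.intCast_surjective (Multiplicative.toAdd m)
    have hm : m = Multiplicative.ofAdd (i : ZMod p) := by rw [hi]; rfl
    rw [hm, hφ]
    rcases n with j | j <;> obtain ⟨j, rfl⟩ := ZMod.intCast_surjective j
    · rw [hψr]; exact hcz.zpow_zpow i j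
    · rw [hψs]; exact (hcx.zpow_left i).mul_right (hcz.zpow_zpow i j)
  let F := φ.noncommCoprod ψ hcomm
  have hFx : x ∈ F.range := ⟨(1, DihedralGroup.sr ((0 : ℤ) : ZMod 4)), by
    simp only [F, MonoidHom.noncommCoprod_apply, hψs]; simp⟩
  have hFz : z ∈ F.range := by
    obtain ⟨u, v, huv⟩ := hcop
    refine ⟨(Multiplicative.ofAdd ((u : ℤ) : ZMod p), DihedralGroup.r ((v : ℤ) : ZMod 4)), ?_⟩
    simp only [F, MonoidHom.noncommCoprod_apply, hψr, hφ]
    rw [← zpow_natCast, ← zpow_natCast, ← zpow_mul, ← zpow_mul, ← zpow_add]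
    have : ((4 : ℕ) : ℤ) * u + (p : ℤ) * v = 1 := by push_cast; linear_combination huv
    rw [this, zpow_one]
  have hFy : y ∈ F.range := by rw [hy]; exact inv_mem (mul_mem hFz hFx)
  have hsurj : Function.Surjective F := by
    rw [← MonoidHom.range_eq_top, eq_top_iff, ← hgen, Subgroup.closure_le]
    rintro g (rfl | rfl | rfl)
    exacts [hFx, hFy, hFz]
  have hbij : Function.Bijective F := by
    rw [Nat.bijective_iff_surjective_and_card]
    refine ⟨hsurj, ?_⟩
    rw [Nat.card_prod, DihedralGroup.nat_card, Nat.card_eq_fintype_card (α := G), hcard]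
    have : Nat.card (Multiplicative (ZMod p)) = p := by simp
    rw [this]; ring
  exact ⟨(MulEquiv.ofBijective F hbij).symm⟩
end

section
/- Let p ≥ 5 be a prime number and let G be a finite group of order 12p. Suppose there exist elements x, y, z ∈ G with x·y·z = 1, orderOf x = 2, orderOf y = 6, orderOf z = 2p, and such that {x, y, z} generates G. Then G is isomorphic to the direct product D_3 × D_p of a dihedral group of order 6 and a dihedral group of order 2p. -/
theorem dihedral_hom_exists {G : Type*} [Group G] (n : ℕ) [NeZero n] (a c : G)
    (ha : a ^ n = 1) (hc : c * c = 1) (hca : c * a = a⁻¹ * c) :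
    ∃ f : DihedralGroup n →* G, (∀ i, f (DihedralGroup.r i) = a ^ i.val) ∧
      (∀ i, f (DihedralGroup.sr i) = c * a ^ i.val) := by
  have hadd : ∀ i j : ZMod n, a ^ (i + j).val = a ^ i.val * a ^ j.val := by
    intro i j
    rw [ZMod.val_add, ← pow_add]
    conv_rhs => rw [← Nat.mod_add_div (i.val + j.val) n, pow_add, pow_mul, ha, one_pow, mul_one]
  have hsub : ∀ i j : ZMod n, a ^ (j - i).val = (a ^ i.val)⁻¹ * a ^ j.val := by
    intro i j
    rw [eq_inv_mul_iff_mul_eq, ← hadd]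
    congr 2
    ring
  have hck : ∀ k : ℕ, c * a ^ k = (a ^ k)⁻¹ * c := by
    intro k
    have h : SemiconjBy c a a⁻¹ := hca
    have := h.pow_right k
    rw [inv_pow] at this
    exact this
  have hck' : ∀ k : ℕ, a ^ k * c = c * (a ^ k)⁻¹ := by
    intro k
    rw [eq_mul_inv_iff_mul_eq, mul_assoc, hck, mul_inv_cancel_left]
  refine ⟨MonoidHom.mk' (fun d => match d with
    | DihedralGroup.r i => a ^ i.val
    | DihedralGroup.sr i => c * a ^ i.val) ?_, fun i => rfl, fun i => rfl⟩
  rintro (i | i) (j | j)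
  · exact hadd i j
  · change c * a ^ (j - i).val = a ^ i.val * (c * a ^ j.val)
    rw [hsub, ← mul_assoc, ← mul_assoc, hck']
  · change c * a ^ (i + j).val = c * a ^ i.val * a ^ j.val
    rw [hadd, mul_assoc]
  · change a ^ (j - i).val = c * a ^ i.val * (c * a ^ j.val)
    rw [hsub, hck, mul_assoc, ← mul_assoc c c, hc, one_mul]

theorem not_normalizer_le {G : Type*} [Group G] [Finite G] (p : ℕ) [Fact p.Prime] (hp5 : 5 ≤ p)
    (P : Sylow p G) (hPc : Nat.card P = p) (x y z : G) (hxyz : x * y * z = 1)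
    (hx : x ^ 2 = 1) (hy : y ^ 6 = 1)
    (hgen : Subgroup.closure ({x, y, z} : Set G) = ⊤) :
    ¬ (Subgroup.normalizer (P : Set G) ≤ Subgroup.centralizer (P : Set G)) := by
  intro hP
  have hp : p.Prime := Fact.out
  have hnd : ∀ k, 0 < k → k < p → Nat.Coprime k p := fun k h0 h1 =>
    ((hp.coprime_iff_not_dvd.2 (Nat.not_dvd_of_pos_of_lt h0 h1)).symm)
  have key : ∀ (g : G) (m : ℕ), g ^ m = 1 → Nat.Coprime m p →
      MonoidHom.transferSylow P hP g = 1 := by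
    intro g m hg hm
    have h1 : (MonoidHom.transferSylow P hP g) ^ m = 1 := by rw [← map_pow, hg, map_one]
    have h2 : (MonoidHom.transferSylow P hP g) ^ p = 1 := by
      have h3 : (MonoidHom.transferSylow P hP g) ^ Nat.card P = 1 := pow_card_eq_one'
      rwa [hPc] at h3
    have := pow_gcd_eq_one.2 ⟨h1, h2⟩
    rwa [hm.gcd_eq_one, pow_one] at this
  have h2p := hnd 2 (by omega) (by omega)
  have h3p := hnd 3 (by omega) (by omega)
  have kx := key x 2 hx h2p
  have ky := key y 6 hy (by
    have := Nat.Coprime.mul_left h2p h3p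
    simpa using this)
  have kz : MonoidHom.transferSylow P hP z = 1 := by
    have := congrArg (MonoidHom.transferSylow P hP) hxyz
    simpa [map_mul, kx, ky] using this
  have htop : (MonoidHom.transferSylow P hP).ker = ⊤ := by
    rw [eq_top_iff, ← hgen, Subgroup.closure_le]
    rintro g (rfl | rfl | rfl) <;> assumption
  apply MonoidHom.not_dvd_card_ker_transferSylow P hP
  rw [htop, Subgroup.card_top]
  have h5 : Nat.card P ∣ Nat.card G := Subgroup.card_subgroup_dvd_card _
  rwa [hPc] at h5

theorem normalizer_eq_top_aux {G : Type*} [Group G] [Finite G] (p : ℕ) [Fact p.Prime]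
    (hp5 : 5 ≤ p) (hcard : Nat.card G = 12 * p)
    (P : Sylow p G) (z : G) (hz : orderOf z = 2 * p)
    (hzP : z ∈ Subgroup.centralizer (P : Set G))
    (hP : ¬ (Subgroup.normalizer (P : Set G) ≤ Subgroup.centralizer (P : Set G))) :
    Subgroup.normalizer (P : Set G) = ⊤ := by
  have hp : p.Prime := Fact.out
  set N := Subgroup.normalizer (P : Set G) with hN
  set C := Subgroup.centralizer (P : Set G) with hC
  have hCN : C ≤ N := Subgroup.centralizer_le_normalizer _
  have h1 : N.index ≡ 1 [MOD p] := by
    rw [hN, ← P.card_eq_index_normalizer]; exact card_sylow_modEq_one p G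
  have h2 : Nat.card C * C.relIndex N * N.index = 12 * p := by
    rw [mul_assoc, Subgroup.relIndex_mul_index hCN, Subgroup.card_mul_index, hcard]
  have h3 : 2 * p ∣ Nat.card C := by
    rw [← hz]; exact Subgroup.orderOf_dvd_natCard C hzP
  have h4 : C.relIndex N ≠ 1 := fun h => hP (Subgroup.relIndex_eq_one.mp h)
  obtain ⟨m, hm⟩ := h3
  rw [hm] at h2
  have h5 : m * C.relIndex N * N.index = 6 := by
    have : (2 * p) * (m * C.relIndex N * N.index) = (2 * p) * 6 := by
      rw [← mul_assoc, ← mul_assoc, h2]; ring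
    exact Nat.eq_of_mul_eq_mul_left (by omega) this
  generalize C.relIndex N = k at *
  rw [← Subgroup.index_eq_one]
  generalize N.index = i at *
  have hi0 : i ≠ 0 := by rintro rfl; simp at h5
  have hm0 : m ≠ 0 := by rintro rfl; simp at h5
  have hk0 : k ≠ 0 := by rintro rfl; simp at h5
  have hi : i ≤ 3 := by
    have : 2 ≤ m * k := by
      have : 1 * 2 ≤ m * k := Nat.mul_le_mul (by omega) (by omega)
      omega
    nlinarith
  unfold Nat.ModEq at h1
  rwa [Nat.mod_eq_of_lt (by omega), Nat.mod_eq_of_lt (by omega)] at h1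

theorem stmt_7 (p : ℕ) (hp : p.Prime) (hp5 : 5 ≤ p)
    (G : Type*) [Group G] [Fintype G] (hcard : Fintype.card G = 12 * p)
    (h : ∃ x y z : G, x * y * z = 1 ∧ orderOf x = 2 ∧ orderOf y = 6 ∧
      orderOf z = 2 * p ∧ Subgroup.closure ({x, y, z} : Set G) = ⊤) :
    Nonempty (G ≃* DihedralGroup 3 × DihedralGroup p) := by
  obtain ⟨x, y, z, hxyz, hx, hy, hz, hgen⟩ := h
  have : Fact p.Prime := ⟨hp⟩
  have : NeZero p := ⟨hp.ne_zero⟩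
  rw [← Nat.card_eq_fintype_card] at hcard
  have hx2 : x ^ 2 = 1 := by rw [← hx]; exact pow_orderOf_eq_one x
  have hy6 : y ^ 6 = 1 := by rw [← hy]; exact pow_orderOf_eq_one y
  have hz2p : z ^ (2 * p) = 1 := by rw [← hz]; exact pow_orderOf_eq_one z
  obtain ⟨a, ha⟩ : ∃ a, a = z ^ 2 := ⟨_, rfl⟩
  have hao : orderOf a = p := by
    rw [ha, orderOf_pow_of_dvd (by norm_num) (by rw [hz]; exact dvd_mul_right 2 p), hz]
    simp
  have haz : z * a = a * z := by rw [ha]; group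
  have hPc : Nat.card (Subgroup.zpowers a) = p := by rw [Nat.card_zpowers, hao]
  have hidx : ¬ p ∣ (Subgroup.zpowers a).index := by
    have h1 := (Subgroup.zpowers a).card_mul_index
    rw [hPc, hcard, mul_comm 12 p] at h1
    have h2 := Nat.eq_of_mul_eq_mul_left hp.pos h1
    rw [h2]
    intro h3
    have : p ∣ 2 * 2 * 3 := h3
    rw [hp.dvd_mul, hp.dvd_mul] at this
    rcases this with (h | h) | h <;> have := Nat.le_of_dvd (by norm_num) h <;> omega
  obtain ⟨P, hPdef⟩ : ∃ P : Sylow p G, (P : Subgroup G) = Subgroup.zpowers a :=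
    ⟨(IsPGroup.of_card (n := 1) (by rw [hPc, pow_one])).toSylow hidx, rfl⟩
  have hPset : (P : Set G) = (Subgroup.zpowers a : Set G) := by
    rw [← hPdef]; rfl
  have hPc' : Nat.card P = p := by
    change Nat.card (P : Subgroup G) = p
    rw [hPdef, hPc]
  have hnot := not_normalizer_le p hp5 P hPc' x y z hxyz hx2 hy6 hgen
  have hcent : ∀ g : G, g * a = a * g → g ∈ Subgroup.centralizer (P : Set G) := by
    intro g hg
    rw [hPset, Subgroup.mem_centralizer_iff]
    rintro _ ⟨k, rfl⟩
    exact ((show Commute g a from hg).zpow_right k).symm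
  have hNtop := normalizer_eq_top_aux p hp5 hcard P z hz (hcent z haz) hnot
  have hnorm : ∀ g : G, ∃ k : ℤ, g * a * g⁻¹ = a ^ k := by
    intro g
    have hg : g ∈ Subgroup.normalizer (P : Set G) := by rw [hNtop]; trivial
    rw [hPset, Subgroup.mem_normalizer_iff] at hg
    have h1 := (hg a).1 (Subgroup.mem_zpowers a)
    obtain ⟨k, hk⟩ := h1
    exact ⟨k, hk.symm⟩
  have hzp1 : ∀ k : ℤ, a ^ k = 1 ↔ (p : ℤ) ∣ k := by
    intro k; rw [← hao]; exact orderOf_dvd_iff_zpow_eq_one.symm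
  -- x inverts a
  have hxa : x * a * x⁻¹ = a⁻¹ := by
    obtain ⟨m, hm⟩ := hnorm x
    have h1 : x * (x * a * x⁻¹) * x⁻¹ = a := by
      have : x * (x * a * x⁻¹) * x⁻¹ = x ^ 2 * a * (x ^ 2)⁻¹ := by
        rw [pow_two, mul_inv_rev]; simp only [mul_assoc]
      rw [this, hx2]; simp
    have h2 : x * (x * a * x⁻¹) * x⁻¹ = a ^ (m * m) := by
      rw [hm, ← conj_zpow, hm, zpow_mul]
    have h3 : a ^ ((m - 1) * (m + 1)) = 1 := by
      have : (m - 1) * (m + 1) = m * m - 1 := by ring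
      rw [this, zpow_sub_one, ← h2, h1, mul_inv_cancel]
    rw [hzp1] at h3
    rcases (Nat.prime_iff_prime_int.mp hp).dvd_or_dvd h3 with h4 | h4
    · exfalso
      rw [← hzp1, zpow_sub_one, mul_inv_eq_one] at h4
      rw [h4, mul_inv_eq_iff_eq_mul] at hm
      apply hnot
      have hC : (⊤ : Subgroup G) ≤ Subgroup.centralizer (P : Set G) := by
        rw [← hgen, Subgroup.closure_le]
        have hyx : y = x⁻¹ * z⁻¹ := by
          rw [eq_inv_mul_iff_mul_eq, eq_inv_iff_mul_eq_one, hxyz]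
        rintro g (rfl | rfl | rfl)
        · exact hcent _ hm
        · rw [hyx]
          exact mul_mem (inv_mem (hcent _ hm)) (inv_mem (hcent _ haz))
        · exact hcent _ haz
      exact le_top.trans hC
    · rw [← hzp1, zpow_add_one, mul_eq_one_iff_eq_inv] at h4
      rw [hm, h4]
  have hxx : x⁻¹ = x := by rw [inv_eq_iff_mul_eq_one, ← pow_two, hx2]
  have hyx : y = x * z⁻¹ := by
    rw [← hxx, eq_inv_mul_iff_mul_eq, eq_inv_iff_mul_eq_one, hxyz]
  have hxa' : SemiconjBy x a a⁻¹ := by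
    rw [mul_inv_eq_iff_eq_mul] at hxa; exact hxa
  have hya : SemiconjBy y a a⁻¹ := by
    rw [hyx]
    exact hxa'.mul_left (show Commute z a from haz).inv_left
  obtain ⟨q, hq⟩ : ∃ q, p = 2 * q + 1 := by
    rcases hp.eq_two_or_odd' with h | h
    · omega
    · exact h
  obtain ⟨t, ht⟩ : ∃ t, t = z ^ p := ⟨_, rfl⟩
  have htt : t * t = 1 := by rw [ht, ← pow_add, ← two_mul, hz2p]
  have htz : t = z * a ^ q := by rw [ht, ha, ← pow_mul, ← pow_succ', ← hq]
  have hta : Commute t a := by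
    rw [htz]; exact (show Commute z a from haz).mul_left (Commute.pow_self a q)
  have hti : t⁻¹ = t := by rw [inv_eq_iff_mul_eq_one, htt]
  -- t y t = y⁻¹
  have htx : t * y * t = y⁻¹ := by
    -- z = t a^(-q), y = x z⁻¹ = x a^q t
    have hz' : z⁻¹ = a ^ q * t := by
      rw [inv_eq_iff_mul_eq_one, ← mul_assoc, ← htz, htt]
    have hy1 : y = x * a ^ q * t := by rw [hyx, hz', mul_assoc]
    have e1 : t * y * t = t * x * a ^ q := by
      rw [hy1]
      calc t * (x * a ^ q * t) * t = t * x * a ^ q * (t * t) := by group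
        _ = _ := by rw [htt, mul_one]
    have e2 : y⁻¹ = t * (a ^ q)⁻¹ * x := by
      rw [hy1]; simp only [mul_inv_rev, hti, hxx, mul_assoc]
    have e3 : (a ^ q)⁻¹ * x = x * a ^ q := by
      have := hxa'.pow_right q
      rw [inv_pow] at this
      exact this.symm
    rw [e1, e2, mul_assoc, mul_assoc, e3]
  have hty : SemiconjBy t y y⁻¹ := by
    change t * y = y⁻¹ * t
    rw [← htx, mul_assoc, htt, mul_one]
  obtain ⟨b, hb⟩ : ∃ b, b = y ^ 2 := ⟨_, rfl⟩
  obtain ⟨c, hc⟩ : ∃ c, c = y ^ 3 := ⟨_, rfl⟩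
  have hcc : c * c = 1 := by rw [hc, ← pow_add, hy6]
  have hb3 : b ^ 3 = 1 := by rw [hb, ← pow_mul, hy6]
  have hap : a ^ p = 1 := by rw [← hao]; exact pow_orderOf_eq_one a
  have htb : t * b = b⁻¹ * t := by
    have := hty.pow_right 2
    rwa [inv_pow, ← hb] at this
  have htc : Commute t c := by
    have := hty.pow_right 3
    rw [inv_pow, ← hc, inv_eq_iff_mul_eq_one.2 hcc] at this
    exact this
  have hbc : Commute b c := by rw [hb, hc]; exact Commute.pow_pow_self y 2 3
  have hba : Commute b a := by
    have h1 : SemiconjBy y a⁻¹ a := by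
      have := hya.inv_right
      rwa [inv_inv] at this
    rw [hb, pow_two]
    exact h1.mul_left hya
  have hca : c * a = a⁻¹ * c := by
    have h1 : SemiconjBy c a a⁻¹ := by
      rw [hc, pow_succ', ← hb]
      exact hya.mul_left hba
    exact h1
  obtain ⟨f, hf1, hf2⟩ := dihedral_hom_exists 3 b t hb3 htt htb
  obtain ⟨g, hg1, hg2⟩ := dihedral_hom_exists p a c hap hcc hca
  have hcomm : ∀ d e, Commute (f d) (g e) := by
    rintro (d | d) (e | e)
    · rw [hf1, hg1]; exact hba.pow_pow _ _
    · rw [hf1, hg2]; exact (hbc.mul_right (hba.pow_right _)).pow_left _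
    · rw [hf2, hg1]; exact hta.mul_left (hba.pow_left _) |>.pow_right _
    · rw [hf2, hg2]
      exact (htc.mul_right (hta.pow_right _)).mul_left
        ((hbc.mul_right (hba.pow_right _)).pow_left _)
  let F := MonoidHom.noncommCoprod f g hcomm
  have hsurj : Function.Surjective F := by
    rw [← MonoidHom.range_eq_top, eq_top_iff, ← hgen, Subgroup.closure_le]
    have hone3 : (1 : ZMod 3).val = 1 := rfl
    have honep : (1 : ZMod p).val = 1 := ZMod.val_one'' (by omega)
    have mb : b ∈ F.range := ⟨(DihedralGroup.r 1, 1), by simp [F, hf1, hone3]⟩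
    have mt : t ∈ F.range := ⟨(DihedralGroup.sr 0, 1), by simp [F, hf2]⟩
    have ma : a ∈ F.range := ⟨(1, DihedralGroup.r 1), by simp [F, hg1, honep]⟩
    have mc : c ∈ F.range := ⟨(1, DihedralGroup.sr 0), by simp [F, hg2]⟩
    have my : y ∈ F.range := by
      have : y = c * b⁻¹ := by rw [hb, hc]; group
      rw [this]; exact mul_mem mc (inv_mem mb)
    have mz : z ∈ F.range := by
      have : z = t * (a ^ q)⁻¹ := by rw [htz]; group
      rw [this]; exact mul_mem mt (inv_mem (pow_mem ma q))
    have mx : x ∈ F.range := by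
      have : x = y * z := by rw [hyx]; group
      rw [this]; exact mul_mem my mz
    rintro w (rfl | rfl | rfl) <;> assumption
  have hbij : Function.Bijective F := by
    rw [Nat.bijective_iff_surjective_and_card]
    refine ⟨hsurj, ?_⟩
    rw [Nat.card_prod, DihedralGroup.nat_card, DihedralGroup.nat_card, hcard]
    ring
  exact ⟨(MulEquiv.ofBijective F hbij).symm⟩
end

section
/- Let p ≥ 5 be a prime number and let G be a finite group of order 12p. Suppose there exist elements x, y, z ∈ G with x·y·z = 1, orderOf x = 3, orderOf y = 3, orderOf z = 2p, and such that {x, y, z} generates G. Then p ≡ 1 (mod 3), and there exists a nontrivial homomorphism φ from the alternating group A4 to the automorphism group of the cyclic group Z_p of order p such that G is isomorphic to the semidirect product Z_p ⋊_φ A4. -/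
theorem aux_gen {G M : Type*} [Group G] [Group M] {x y : G}
    (hgen : Subgroup.closure ({x, y} : Set G) = ⊤) (f : G →* M) (hx : f x = 1) (hy : f y = 1) :
    f = 1 := by
  apply MonoidHom.eq_of_eqOn_dense hgen
  rintro g (rfl | rfl) <;> simp_all

theorem aux_coprime {M : Type*} [Group M] {n : ℕ} {a : M} (h3 : a ^ 3 = 1) (hn : a ^ n = 1)
    (hc : Nat.Coprime 3 n) : a = 1 := by
  have h1 := orderOf_dvd_of_pow_eq_one h3
  have h2 := orderOf_dvd_of_pow_eq_one hn
  exact orderOf_eq_one_iff.1 (Nat.eq_one_of_dvd_coprimes hc h1 h2)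

theorem aux_A4 {Q : Type*} [Group Q] [Finite Q] (hQ : Nat.card Q = 12) {a b : Q}
    (ha : a ^ 3 = 1) (hb : b ^ 3 = 1) (hgen : Subgroup.closure ({a, b} : Set Q) = ⊤) :
    Nonempty (Q ≃* alternatingGroup (Fin 4)) := by
  have : Fact (Nat.Prime 3) := ⟨Nat.prime_three⟩
  have hcardP : ∀ P : Sylow 3 Q, Nat.card P = 3 := by
    intro P
    rw [P.card_eq_multiplicity, hQ]
    have : (12 : ℕ).factorization 3 = 1 := by
      rw [Nat.factorization_def _ Nat.prime_three]
      have : (12 : ℕ) = 3 ^ 1 * 4 := by norm_num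
      rw [this, padicValNat.mul (by norm_num) (by norm_num), padicValNat.prime_pow,
        padicValNat.eq_zero_of_not_dvd (by norm_num)]
    rw [this]; norm_num
  have hmod := card_sylow_modEq_one 3 Q
  have hcn : ∀ P : Sylow 3 Q, Nat.card (Sylow 3 Q) * Nat.card (Subgroup.normalizer (P : Set Q)) = 12 := by
    intro P
    rw [P.card_eq_index_normalizer, mul_comm, Subgroup.card_mul_index, hQ]
  have hns : ¬ Subsingleton (Sylow 3 Q) := by
    intro hs
    have hmem : ∀ (P : Sylow 3 Q) (c : Q), c ^ 3 = 1 → c ∈ P := by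
      intro P c hc
      have : IsPGroup 3 (Subgroup.zpowers c) := by
        have h1 : Nat.card (Subgroup.zpowers c) ∣ 3 ^ 1 := by
          rw [Nat.card_zpowers]; exact orderOf_dvd_of_pow_eq_one (by simpa using hc)
        obtain ⟨k, -, hk⟩ := (Nat.dvd_prime_pow Nat.prime_three).1 h1
        exact IsPGroup.of_card hk
      obtain ⟨R, hR⟩ := this.exists_le_sylow
      rw [Subsingleton.elim P R]
      exact hR (Subgroup.mem_zpowers c)
    let P : Sylow 3 Q := default
    have : (⊤ : Subgroup Q) ≤ P := by
      rw [← hgen, Subgroup.closure_le]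
      rintro g (rfl | rfl)
      · exact hmem P _ ha
      · exact hmem P _ hb
    have h2 := Subgroup.card_le_of_le this
    rw [Subgroup.card_top, hQ] at h2
    have := hcardP P
    change Nat.card (P : Subgroup Q) = 3 at this
    omega
  have hn4 : Nat.card (Sylow 3 Q) = 4 := by
    have hd : Nat.card (Sylow 3 Q) ∣ 12 := ⟨_, (hcn default).symm⟩
    have hle := Nat.le_of_dvd (by norm_num) hd
    have hne1 : Nat.card (Sylow 3 Q) ≠ 1 := fun h =>
      hns (Nat.card_eq_one_iff_unique.1 h).1
    generalize Nat.card (Sylow 3 Q) = n at *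
    unfold Nat.ModEq at hmod
    interval_cases n <;> omega
  have hnorm : ∀ P : Sylow 3 Q, Subgroup.normalizer (P : Set Q) = P := by
    intro P
    symm
    apply Subgroup.eq_of_le_of_card_ge P.le_normalizer
    have h1 : 4 * Nat.card (Subgroup.normalizer ((P : Subgroup Q) : Set Q)) = 12 := hn4 ▸ hcn P
    have h2 : Nat.card (P : Subgroup Q) = 3 := hcardP P
    change Nat.card (Subgroup.normalizer ((P : Subgroup Q) : Set Q)) ≤ Nat.card (P : Subgroup Q)
    omega
  let e : Sylow 3 Q ≃ Fin 4 := Finite.equivFinOfCardEq hn4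
  let f : Q →* Equiv.Perm (Fin 4) := e.permCongrHom.toMonoidHom.comp (MulAction.toPermHom Q (Sylow 3 Q))
  have hker : ∀ P : Sylow 3 Q, f.ker ≤ P := by
    intro P g hg
    rw [← hnorm P]
    have h1 : MulAction.toPermHom Q (Sylow 3 Q) g = 1 := by
      have : e.permCongrHom (MulAction.toPermHom Q (Sylow 3 Q) g) = 1 := hg
      exact (map_eq_one_iff _ e.permCongrHom.injective).1 this
    have h2 : g • P = P := by
      have := congrArg (fun s : Equiv.Perm (Sylow 3 Q) => s P) h1
      simpa using this
    exact Sylow.smul_eq_iff_mem_normalizer.1 h2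
  have hinj : Function.Injective f := by
    rw [← MonoidHom.ker_eq_bot_iff]
    have hd : Nat.card f.ker ∣ 3 := by
      have h2 := hcardP default
      change Nat.card ((default : Sylow 3 Q) : Subgroup Q) = 3 at h2
      rw [← h2]
      exact Subgroup.card_dvd_of_le (hker default)
    rcases (Nat.dvd_prime Nat.prime_three).1 hd with h | h
    · exact Subgroup.card_eq_one.1 h
    · exfalso
      have : ∀ P : Sylow 3 Q, f.ker = P := by
        intro P
        apply Subgroup.eq_of_le_of_card_ge (hker P)
        have h2 := hcardP P
        change Nat.card (P : Subgroup Q) = 3 at h2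
        omega
      exact hns ⟨fun P R => Sylow.ext ((this P).symm.trans (this R))⟩
  have hsign : Equiv.Perm.sign.comp f = 1 := by
    have key : ∀ u : ℤˣ, u ^ 3 = 1 → u = 1 := by decide
    apply aux_gen hgen
    · exact key _ (by rw [← map_pow, ha, map_one])
    · exact key _ (by rw [← map_pow, hb, map_one])
  let g : Q →* alternatingGroup (Fin 4) := f.codRestrict _ (fun q => by
    rw [Equiv.Perm.mem_alternatingGroup]
    exact DFunLike.congr_fun hsign q)
  have hginj : Function.Injective g := fun u v huv => hinj (congrArg Subtype.val huv)
  have hcA : Nat.card (alternatingGroup (Fin 4)) = 12 := by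
    rw [nat_card_alternatingGroup]; simp [Nat.factorial]
  exact ⟨MulEquiv.ofBijective g
    ((Nat.bijective_iff_injective_and_card g).2 ⟨hginj, by rw [hQ, hcA]⟩)⟩

theorem aux_normal {p : ℕ} (hp : p.Prime) (hp5 : 5 ≤ p)
    {G : Type*} [Group G] [Finite G] (hcard : Nat.card G = 12 * p) {x y z : G}
    (hx : x ^ 3 = 1) (hy : y ^ 3 = 1) (hz : orderOf z = 2 * p)
    (hgen : Subgroup.closure ({x, y} : Set G) = ⊤) :
    ∃ P : Subgroup G, P.Normal ∧ Nat.card P = p := by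
  have : Fact p.Prime := ⟨hp⟩
  have hc3 : Nat.Coprime 3 p := (Nat.coprime_primes Nat.prime_three hp).2 (by omega)
  have hz2 : orderOf (z ^ 2) = p := by
    rw [orderOf_pow' _ (by norm_num), hz]; simp
  have hP0 : Nat.card (Subgroup.zpowers (z ^ 2)) = p := by
    rw [Nat.card_zpowers, hz2]
  have hfac : (12 * p).factorization p = 1 := by
    rw [Nat.factorization_def _ hp, padicValNat.mul (by norm_num) hp.ne_zero, padicValNat_self,
      padicValNat.eq_zero_of_not_dvd]
    intro hd
    have h12 : p ∣ 2 ^ 2 * 3 := hd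
    rcases (Nat.Prime.dvd_mul hp).1 h12 with h | h
    · have := Nat.le_of_dvd (by norm_num) (hp.dvd_of_dvd_pow h); omega
    · have := Nat.le_of_dvd (by norm_num) h; omega
  let P : Sylow p G := Sylow.ofCard (Subgroup.zpowers (z ^ 2)) (by rw [hP0, hcard, hfac, pow_one])
  have hPc : (P : Subgroup G) = Subgroup.zpowers (z ^ 2) := Sylow.coe_ofCard _ _
  refine ⟨P, ?_, by rw [hPc, hP0]⟩
  have hzc : Subgroup.zpowers z ≤ Subgroup.centralizer (P : Set G) := by
    rw [Subgroup.zpowers_le, Subgroup.mem_centralizer_iff]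
    intro h hh
    have hh' : h ∈ Subgroup.zpowers (z ^ 2) := by rw [← hPc]; exact hh
    obtain ⟨k, rfl⟩ := Subgroup.mem_zpowers_iff.1 hh'
    exact (((Commute.refl z).pow_left 2).zpow_left k).eq
  have hzn : Subgroup.zpowers z ≤ Subgroup.normalizer (P : Set G) :=
    hzc.trans (Subgroup.centralizer_le_normalizer _)
  by_cases hs : Nat.card (Sylow p G) = 1
  · have := (Nat.card_eq_one_iff_unique.1 hs).1
    exact P.normal_of_subsingleton
  exfalso
  have hcn : Nat.card (Sylow p G) * Nat.card (Subgroup.normalizer (P : Set G)) = 12 * p := by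
    rw [P.card_eq_index_normalizer, mul_comm, Subgroup.card_mul_index, hcard]
  obtain ⟨m, hm⟩ : 2 * p ∣ Nat.card (Subgroup.normalizer (P : Set G)) := by
    rw [← hz, ← Nat.card_zpowers]
    exact Subgroup.card_dvd_of_le hzn
  have hmod := card_sylow_modEq_one p G
  have h6 : Nat.card (Sylow p G) * m = 6 := by
    rw [hm] at hcn
    have : 2 * p * (Nat.card (Sylow p G) * m) = 2 * p * 6 := by linarith
    exact Nat.eq_of_mul_eq_mul_left (by omega) this
  have hn6 : Nat.card (Sylow p G) = 6 := by
    have hle := Nat.le_of_dvd (by norm_num) (Dvd.intro _ h6)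
    have h0 : Nat.card (Sylow p G) ≠ 0 := by rintro h; simp [h] at h6
    have := (Nat.modEq_iff_dvd' (by omega)).1 hmod.symm
    have := Nat.le_of_dvd (by omega) this
    omega
  have hm1 : m = 1 := by rw [hn6] at h6; omega
  have hN : Subgroup.zpowers z = Subgroup.normalizer (P : Set G) := by
    apply Subgroup.eq_of_le_of_card_ge hzn
    rw [hm, hm1, Nat.card_zpowers, hz, mul_one]
  have hNC : Subgroup.normalizer (P : Set G) ≤ Subgroup.centralizer (P : Set G) := hN ▸ hzc
  have hcP : Nat.card P = p := by
    change Nat.card (P : Subgroup G) = p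
    rw [hPc, hP0]
  have htriv : MonoidHom.transferSylow P hNC = 1 := by
    have hpow : ∀ t : P, t ^ p = 1 := by
      intro t
      have : t ^ Nat.card (P : Subgroup G) = 1 := pow_card_eq_one' (x := t)
      rwa [hcP] at this
    apply aux_gen hgen
    · exact aux_coprime (by rw [← map_pow, hx, map_one]) (hpow _) hc3
    · exact aux_coprime (by rw [← map_pow, hy, map_one]) (hpow _) hc3
  apply MonoidHom.not_dvd_card_ker_transferSylow P hNC
  rw [htriv, MonoidHom.ker_one, Subgroup.card_top, hcard]
  exact Dvd.intro_left _ rfl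

theorem stmt_8 (p : ℕ) (hp : p.Prime) (hp5 : 5 ≤ p)
    (G : Type*) [Group G] [Fintype G] (hcard : Fintype.card G = 12 * p)
    (h : ∃ x y z : G, x * y * z = 1 ∧ orderOf x = 3 ∧ orderOf y = 3 ∧
      orderOf z = 2 * p ∧ Subgroup.closure ({x, y, z} : Set G) = ⊤) :
    p % 3 = 1 ∧
      ∃ φ : alternatingGroup (Fin 4) →* MulAut (Multiplicative (ZMod p)),
        φ ≠ 1 ∧ Nonempty (G ≃* Multiplicative (ZMod p) ⋊[φ] alternatingGroup (Fin 4)) := by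
  obtain ⟨x, y, z, hxyz, hx, hy, hz, hgen3⟩ := h
  have : Fact p.Prime := ⟨hp⟩
  have hc3 : Nat.Coprime 3 p := (Nat.coprime_primes Nat.prime_three hp).2 (by omega)
  have hx3 : x ^ 3 = 1 := hx ▸ pow_orderOf_eq_one x
  have hy3 : y ^ 3 = 1 := hy ▸ pow_orderOf_eq_one y
  have hcG : Nat.card G = 12 * p := by rw [Nat.card_eq_fintype_card, hcard]
  have hgen : Subgroup.closure ({x, y} : Set G) = ⊤ := by
    rw [eq_top_iff, ← hgen3, Subgroup.closure_le]
    have h1 : x ∈ Subgroup.closure ({x, y} : Set G) := Subgroup.subset_closure (by simp)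
    have h2 : y ∈ Subgroup.closure ({x, y} : Set G) := Subgroup.subset_closure (by simp)
    rintro g (rfl | rfl | rfl)
    · exact h1
    · exact h2
    · rw [eq_inv_of_mul_eq_one_right hxyz]
      exact inv_mem (mul_mem h1 h2)
  obtain ⟨P, hPn, hPc⟩ := aux_normal hp hp5 hcG hx3 hy3 hz hgen
  have hidx : P.index = 12 := by
    have := P.card_mul_index
    rw [hPc, hcG, mul_comm] at this
    exact Nat.eq_of_mul_eq_mul_right hp.pos this
  have hc12 : Nat.Coprime p 12 := by
    have h2 : Nat.Coprime p 2 := (Nat.coprime_primes hp Nat.prime_two).2 (by omega)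
    exact (h2.mul_right h2).mul_right hc3.symm
  obtain ⟨K, hK⟩ := Subgroup.exists_right_complement'_of_coprime (N := P) (by rw [hPc, hidx]; exact hc12)
  have hKc : Nat.card K = 12 := by rw [← hK.symm.index_eq_card, hidx]
  let e := SemidirectProduct.mulEquivSubgroup hK
  let r : G →* K := SemidirectProduct.rightHom.comp e.symm.toMonoidHom
  have hr : Function.Surjective r := SemidirectProduct.rightHom_surjective.comp e.symm.surjective
  obtain ⟨eK⟩ : Nonempty (K ≃* alternatingGroup (Fin 4)) := by
    refine aux_A4 hKc (a := r x) (b := r y) (by rw [← map_pow, hx3, map_one])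
      (by rw [← map_pow, hy3, map_one]) ?_
    have := congrArg (Subgroup.map r) hgen
    rwa [MonoidHom.map_closure, Set.image_pair, Subgroup.map_top_of_surjective r hr] at this
  have hcZ : Nat.card (Multiplicative (ZMod p)) = p := by simp
  let eP : P ≃* Multiplicative (ZMod p) := mulEquivOfPrimeCardEq hPc hcZ
  let E := e.symm.trans (SemidirectProduct.congr' eP eK)
  suffices H : ∀ φ : alternatingGroup (Fin 4) →* MulAut (Multiplicative (ZMod p)),
      (G ≃* Multiplicative (ZMod p) ⋊[φ] alternatingGroup (Fin 4)) → p % 3 = 1 ∧ φ ≠ 1 from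
    ⟨(H _ E).1, _, (H _ E).2, ⟨E⟩⟩
  intro φ F
  have hne : φ ≠ 1 := by
    rintro rfl
    let q : G →* Multiplicative (ZMod p) :=
      (MonoidHom.fst _ _).comp (SemidirectProduct.mulEquivProd.toMonoidHom.comp F.toMonoidHom)
    have hq : Function.Surjective q := by
      intro t
      obtain ⟨g, hg⟩ := (F.trans SemidirectProduct.mulEquivProd).surjective (t, 1)
      exact ⟨g, congrArg Prod.fst hg⟩
    have hpow : ∀ t : Multiplicative (ZMod p), t ^ p = 1 := by
      intro t
      have := pow_card_eq_one' (x := t)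
      rwa [hcZ] at this
    have hq1 : q = 1 := by
      apply aux_gen hgen
      · exact aux_coprime (by rw [← map_pow, hx3, map_one]) (hpow _) hc3
      · exact aux_coprime (by rw [← map_pow, hy3, map_one]) (hpow _) hc3
    have hsub : Subsingleton (Multiplicative (ZMod p)) := by
      refine ⟨fun s t => ?_⟩
      obtain ⟨s', rfl⟩ := hq s
      obtain ⟨t', rfl⟩ := hq t
      simp [hq1]
    have := Nat.card_eq_one_iff_unique.2 ⟨hsub, ⟨1⟩⟩
    omega
  refine ⟨?_, hne⟩
  by_contra hp3
  apply hne
  have hcA : Nat.card (MulAut (Multiplicative (ZMod p))) = p - 1 := by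
    rw [IsCyclic.card_mulAut, hcZ, Nat.totient_prime hp]
  have hc : Nat.Coprime 3 (p - 1) := by
    rw [Nat.Prime.coprime_iff_not_dvd Nat.prime_three]
    omega
  have hpow : ∀ t : MulAut (Multiplicative (ZMod p)), t ^ (p - 1) = 1 := by
    intro t
    have := pow_card_eq_one' (x := t)
    rwa [hcA] at this
  have h1 : φ.comp (SemidirectProduct.rightHom.comp F.toMonoidHom) = 1 := by
    apply aux_gen hgen
    · exact aux_coprime (by rw [← map_pow, hx3, map_one]) (hpow _) hc
    · exact aux_coprime (by rw [← map_pow, hy3, map_one]) (hpow _) hc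
  ext1 k
  obtain ⟨g, rfl⟩ := (SemidirectProduct.rightHom_surjective.comp F.surjective) k
  exact DFunLike.congr_fun h1 g
end

section
/- Let p ≥ 5 be a prime number. The group D_p × Z_4 (the direct product of the dihedral group of order 2p with a cyclic group of order 4) cannot be generated by one element of order 4p together with one element of order 2p; that is, for all x, y in D_p × Z_4 with orderOf x = 4p and orderOf y = 2p, the subgroup closure of {x, y} is a proper subgroup. -/
theorem aux_rot (p k : ℕ) (hp5 : 5 ≤ p) (hk : 0 < k)
    (x : DihedralGroup p × Multiplicative (ZMod 4))
    (hx : orderOf x = k * p) : ∃ i, x.1 = DihedralGroup.r i := by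
  obtain ⟨a, b⟩ := x
  cases a with
  | r i => exact ⟨i, rfl⟩
  | sr i =>
    exfalso
    have hb : ∀ b : Multiplicative (ZMod 4), b ^ 4 = 1 := by decide
    have h : ((DihedralGroup.sr i, b) : DihedralGroup p × Multiplicative (ZMod 4)) ^ 4 = 1 := by
      refine Prod.ext ?_ (hb b)
      change (DihedralGroup.sr i) ^ 4 = 1
      rw [show 4 = 2 * 2 from rfl, pow_mul, pow_two (DihedralGroup.sr i),
        DihedralGroup.sr_mul_self, one_pow]
    have h2 := Nat.le_of_dvd (by norm_num) (orderOf_dvd_of_pow_eq_one h)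
    rw [hx] at h2
    nlinarith

theorem stmt_9 (p : ℕ) (hp : p.Prime) (hp5 : 5 ≤ p)
    (x y : DihedralGroup p × Multiplicative (ZMod 4))
    (hx : orderOf x = 4 * p) (hy : orderOf y = 2 * p) :
    Subgroup.closure ({x, y} : Set (DihedralGroup p × Multiplicative (ZMod 4))) ≠ ⊤ := by
  intro htop
  have key : ∀ g ∈ Subgroup.closure ({x, y} : Set (DihedralGroup p × Multiplicative (ZMod 4))),
      ∃ i, g.1 = DihedralGroup.r i := by
    intro g hg
    induction hg using Subgroup.closure_induction with
    | mem g hg =>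
      rcases hg with rfl | rfl
      · exact aux_rot p 4 hp5 (by norm_num) _ hx
      · exact aux_rot p 2 hp5 (by norm_num) _ hy
    | one => exact ⟨0, rfl⟩
    | mul a b _ _ ha hb =>
      obtain ⟨i, hi⟩ := ha
      obtain ⟨j, hj⟩ := hb
      exact ⟨i + j, by rw [Prod.fst_mul, hi, hj, DihedralGroup.r_mul_r]⟩
    | inv a _ ha =>
      obtain ⟨i, hi⟩ := ha
      exact ⟨-i, by rw [Prod.fst_inv, hi, DihedralGroup.inv_r]⟩
  obtain ⟨i, hi⟩ := key (DihedralGroup.sr 0, 1) (htop ▸ Subgroup.mem_top _)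
  cases hi
end

section
/- Let p ≥ 5 be a prime number and let Ĝ be a finite group of order 24p. If Ĝ contains a non-normal subgroup G of order 8p that is isomorphic to the direct product Z_p × D_4 of a cyclic group of order p and a dihedral group of order 8, then Ĝ cannot be generated by an element of order 2 together with an element of order 3; that is, for all x, y in Ĝ with orderOf x = 2 and orderOf y = 3, the subgroup closure of {x, y} is a proper subgroup of Ĝ. -/
theorem stmt_11 (p : ℕ) (hp : p.Prime) (hp5 : 5 ≤ p)
    (Ghat : Type*) [Group Ghat] [Fintype Ghat] (hcard : Fintype.card Ghat = 24 * p)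
    (G : Subgroup Ghat) (hGnn : ¬ G.Normal) (hGcard : Nat.card G = 8 * p)
    (hGiso : Nonempty (G ≃* Multiplicative (ZMod p) × DihedralGroup 4))
    (x y : Ghat) (hx : orderOf x = 2) (hy : orderOf y = 3) :
    Subgroup.closure ({x, y} : Set Ghat) ≠ ⊤ := by
  intro htop
  have : Fact p.Prime := ⟨hp⟩
  have hN : Nat.card Ghat = 24 * p := by rw [Nat.card_eq_fintype_card, hcard]
  have hpp : 0 < p := hp.pos
  have hndvd : ¬ p ∣ 144 := by
    intro h
    have h' : p ∣ 2 ^ 4 * 3 ^ 2 := by simpa using h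
    rcases (hp.dvd_mul).1 h' with h | h
    · have := Nat.le_of_dvd (by norm_num) (hp.dvd_of_dvd_pow h); omega
    · have := Nat.le_of_dvd (by norm_num) (hp.dvd_of_dvd_pow h); omega
  have hGidx : G.index = 3 := by
    have h := G.card_mul_index
    rw [hGcard, hN] at h
    have : (8 * p) * G.index = (8 * p) * 3 := by rw [h]; ring
    exact Nat.eq_of_mul_eq_mul_left (by omega) this
  -- the central element of order p in G
  obtain ⟨e⟩ := hGiso
  obtain ⟨z, hz, hzG⟩ : ∃ z : Ghat, orderOf z = p ∧ ∀ g ∈ G, g * z = z * g := by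
    refine ⟨(e.symm (Multiplicative.ofAdd 1, 1) : G), ?_, ?_⟩
    · rw [Subgroup.orderOf_coe, MulEquiv.orderOf_eq, Prod.orderOf_mk]
      simp [ZMod.addOrderOf_one]
    · intro g hg
      have : (⟨g, hg⟩ : G) * e.symm (Multiplicative.ofAdd 1, 1)
          = e.symm (Multiplicative.ofAdd 1, 1) * ⟨g, hg⟩ := by
        apply e.injective
        simp only [map_mul, MulEquiv.apply_symm_apply]
        ext1
        · simp [mul_comm]
        · simp
      exact congrArg Subtype.val this
  have hZc : Nat.card (Subgroup.zpowers z) = p := by rw [Nat.card_zpowers, hz]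
  have hfac : (Nat.card Ghat).factorization p = 1 := by
    rw [hN, Nat.factorization_mul (by norm_num) hpp.ne']
    have : ¬ p ∣ 24 := fun h => hndvd (h.trans (by norm_num))
    simp [Nat.factorization_eq_zero_of_not_dvd this, hp.factorization_self]
  let P : Sylow p Ghat := Sylow.ofCard (Subgroup.zpowers z) (by rw [hZc, hfac, pow_one])
  have hP : (P : Subgroup Ghat) = Subgroup.zpowers z := rfl
  have hGC : G ≤ Subgroup.centralizer (Subgroup.zpowers z : Set Ghat) := by
    intro g hg
    rw [Subgroup.mem_centralizer_iff]
    rintro _ ⟨k, rfl⟩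
    have h : Commute g z := hzG g hg
    exact ((h.zpow_right k).eq).symm
  have hGN : G ≤ Subgroup.normalizer ((P : Subgroup Ghat) : Set Ghat) :=
    hGC.trans (Subgroup.centralizer_le_normalizer _)
  have hnp : Nat.card (Sylow p Ghat) = 1 := by
    have h1 : Nat.card (Sylow p Ghat) ∣ 3 := by
      rw [P.card_eq_index_normalizer, ← hGidx]
      exact Subgroup.index_dvd_of_le hGN
    have h2 := card_sylow_modEq_one p Ghat
    rcases (Nat.dvd_prime Nat.prime_three).1 h1 with h | h
    · exact h
    · rw [h, Nat.ModEq, Nat.mod_eq_of_lt (by omega), Nat.mod_eq_of_lt (by omega)] at h2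
      omega
  have hnorm : (Subgroup.zpowers z).Normal := by
    rw [← hP, ← Subgroup.normalizer_eq_top_iff, ← Subgroup.index_eq_one]
    exact P.card_eq_index_normalizer.symm.trans hnp
  have hCtop : Subgroup.centralizer (Subgroup.zpowers z : Set Ghat) = ⊤ := by
    have h1 := Subgroup.index_dvd_of_le hGC
    rw [hGidx] at h1
    rcases (Nat.dvd_prime Nat.prime_three).1 h1 with h | h
    · exact Subgroup.index_eq_one.1 h
    · exfalso
      apply hGnn
      have hr := Subgroup.relIndex_mul_index hGC
      rw [h, hGidx] at hr
      have hr1 := Subgroup.relIndex_eq_one.1 (Nat.eq_of_mul_eq_mul_right (by norm_num) (hr.trans (one_mul 3).symm))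
      rw [le_antisymm hGC hr1]
      infer_instance
  have hzc : z ∈ Subgroup.center Ghat := by
    rw [Subgroup.mem_center_iff]
    intro g
    have : g ∈ Subgroup.centralizer (Subgroup.zpowers z : Set Ghat) := by rw [hCtop]; trivial
    exact (Subgroup.mem_centralizer_iff.1 this z (Subgroup.mem_zpowers z)).symm
  -- transfer into the center
  have hidx : (Subgroup.center Ghat).index ∣ 24 := by
    have h1 : p ∣ Nat.card (Subgroup.center Ghat) := by
      rw [← hZc]
      exact Subgroup.card_dvd_of_le (by simpa using hzc)
    obtain ⟨c, hc⟩ := h1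
    have h := (Subgroup.center Ghat).card_mul_index
    rw [hc, hN] at h
    refine ⟨c, Nat.eq_of_mul_eq_mul_left hpp ?_⟩
    rw [mul_comm p 24, ← h]; ring
  have hz2 : (z ^ (Subgroup.center Ghat).index) ^ 6 = 1 := by
    have key : ∀ g : Ghat, g ^ 6 = 1 → (g ^ (Subgroup.center Ghat).index) ^ 6 = 1 := by
      intro g hg
      rw [← pow_mul, mul_comm, pow_mul, hg, one_pow]
    have hmem : z ∈ Subgroup.closure ({x, y} : Set Ghat) := by rw [htop]; trivial
    clear hz hzG hZc hGC hnorm hCtop hzc hP hGN P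
    induction hmem using Subgroup.closure_induction with
    | mem g hg =>
      rcases hg with rfl | rfl
      · exact key _ (orderOf_dvd_iff_pow_eq_one.1 (by rw [hx]; norm_num))
      · exact key _ (orderOf_dvd_iff_pow_eq_one.1 (by rw [hy]; norm_num))
    | one => simp
    | mul a b _ _ ha hb =>
      have hm := congrArg Subtype.val (map_mul (MonoidHom.transferCenterPow Ghat) a b)
      have hc := Subgroup.mem_center_iff.1 (MonoidHom.transferCenterPow Ghat b).2
        (a ^ (Subgroup.center Ghat).index)
      simp only [Subgroup.coe_mul, MonoidHom.transferCenterPow_apply] at hm hc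
      have hc' : Commute (a ^ (Subgroup.center Ghat).index) (b ^ (Subgroup.center Ghat).index) := hc
      rw [hm, hc'.mul_pow, ha, hb, one_mul]
    | inv a _ ha => rw [inv_pow, inv_pow, ha, inv_one]
  rw [← pow_mul] at hz2
  have hd := orderOf_dvd_of_pow_eq_one hz2
  rw [hz] at hd
  exact hndvd (hd.trans (by simpa using Nat.mul_dvd_mul hidx (dvd_refl 6)))
end

section
/- Let p ≥ 5 be a prime number and let G be a finite group of order 4p. Then there exist elements x1, x2, x3, x4 ∈ G with x1·x2·x3·x4 = 1, orderOf x1 = 2, orderOf x2 = 2, orderOf x3 = p, orderOf x4 = 2p, and {x1, x2, x3, x4} generating G, if and only if G is isomorphic to Z_p × Z_2 × Z_2 or to the dihedral group D_{2p} of order 4p. -/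
theorem aux_cyc {G : Type*} [Group G] (n : ℕ) (g : G) (hg : g ^ n = 1) :
    ∃ F : Multiplicative (ZMod n) →* G, ∀ k : ℤ,
      F (Multiplicative.ofAdd (k : ZMod n)) = g ^ k := by
  let f : ℤ →+ Additive G := zmultiplesHom (Additive G) (Additive.ofMul g)
  have hf : f n = 0 := by
    simp only [f, zmultiplesHom_apply, natCast_zsmul]
    rw [← ofMul_pow, hg]; rfl
  refine ⟨AddMonoidHom.toMultiplicativeLeft (ZMod.lift n ⟨f, hf⟩), fun k => ?_⟩
  have := ZMod.lift_coe n ⟨f, hf⟩ k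
  change Additive.toMul (ZMod.lift n ⟨f, hf⟩ (k : ZMod n)) = g ^ k
  rw [this]
  simp [f]

theorem aux_dih {G : Type*} [Group G] (n : ℕ) (g t : G) (hg : g ^ n = 1) (ht : t * t = 1)
    (h : t * g * t⁻¹ = g⁻¹) :
    ∃ F : DihedralGroup n →* G, F (DihedralGroup.r 1) = g ∧ F (DihedralGroup.sr 0) = t := by
  obtain ⟨F, hF⟩ := aux_cyc n g hg
  have hcomm : ∀ k : ℤ, g ^ k * t = t * g ^ (-k) := by
    intro k
    have h1 : t * g ^ (-k) * t⁻¹ = g ^ k := by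
      rw [← conj_zpow, h]; simp
    rw [← h1]; group
  have ht' : ∀ x, t * (t * x) = x := fun x => by rw [← mul_assoc, ht, one_mul]
  have hmul : ∀ x y : DihedralGroup n,
      (fun x : DihedralGroup n => match x with
        | DihedralGroup.r i => F (Multiplicative.ofAdd i)
        | DihedralGroup.sr i => t * F (Multiplicative.ofAdd i)) (x * y) =
      (fun x : DihedralGroup n => match x with
        | DihedralGroup.r i => F (Multiplicative.ofAdd i)
        | DihedralGroup.sr i => t * F (Multiplicative.ofAdd i)) x *
      (fun x : DihedralGroup n => match x with
        | DihedralGroup.r i => F (Multiplicative.ofAdd i)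
        | DihedralGroup.sr i => t * F (Multiplicative.ofAdd i)) y := by
    rintro (i | i) (j | j) <;> obtain ⟨i, rfl⟩ := ZMod.intCast_surjective i <;>
      obtain ⟨j, rfl⟩ := ZMod.intCast_surjective j
    · simp only [DihedralGroup.r_mul_r, ← Int.cast_add, hF, zpow_add]
    · simp only [DihedralGroup.r_mul_sr, ← Int.cast_sub, hF]
      rw [← mul_assoc, hcomm, mul_assoc, ← zpow_add]; congr 2; ring
    · simp only [DihedralGroup.sr_mul_r, ← Int.cast_add, hF, zpow_add, mul_assoc]
    · simp only [DihedralGroup.sr_mul_sr, ← Int.cast_sub, hF]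
      rw [mul_assoc, ← mul_assoc (g ^ i), hcomm, mul_assoc, ht', ← zpow_add]; congr 1; ring
  refine ⟨MonoidHom.mk' (fun x : DihedralGroup n => match x with
        | DihedralGroup.r i => F (Multiplicative.ofAdd i)
        | DihedralGroup.sr i => t * F (Multiplicative.ofAdd i)) hmul, ?_, ?_⟩
  · simpa using hF 1
  · simpa using hF 0

theorem aux_ab {G : Type*} [Group G] (p : ℕ) (a b c : G) (ha : a ^ p = 1) (hb : b ^ 2 = 1)
    (hc : c ^ 2 = 1) (hab : Commute a b) (hac : Commute a c) (hbc : Commute b c) :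
    ∃ F : Multiplicative (ZMod p) × Multiplicative (ZMod 2) × Multiplicative (ZMod 2) →* G,
      a ∈ F.range ∧ b ∈ F.range ∧ c ∈ F.range := by
  obtain ⟨A, hA⟩ := aux_cyc p a ha
  obtain ⟨B, hB⟩ := aux_cyc 2 b hb
  obtain ⟨C, hC⟩ := aux_cyc 2 c hc
  have hA' : ∀ x, ∃ k : ℤ, A x = a ^ k := fun x => by
    obtain ⟨k, hk⟩ := ZMod.intCast_surjective (Multiplicative.toAdd x)
    exact ⟨k, by rw [← hA, hk]; rfl⟩
  have hB' : ∀ x, ∃ k : ℤ, B x = b ^ k := fun x => by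
    obtain ⟨k, hk⟩ := ZMod.intCast_surjective (Multiplicative.toAdd x)
    exact ⟨k, by rw [← hB, hk]; rfl⟩
  have hC' : ∀ x, ∃ k : ℤ, C x = c ^ k := fun x => by
    obtain ⟨k, hk⟩ := ZMod.intCast_surjective (Multiplicative.toAdd x)
    exact ⟨k, by rw [← hC, hk]; rfl⟩
  have cBC : ∀ x y, Commute (B x) (C y) := fun x y => by
    obtain ⟨k, hk⟩ := hB' x
    obtain ⟨l, hl⟩ := hC' y
    rw [hk, hl]; exact hbc.zpow_zpow k l
  have cA : ∀ x y, Commute (A x) (B.noncommCoprod C cBC y) := fun x y => by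
    obtain ⟨m, hm⟩ := hA' x
    obtain ⟨k, hk⟩ := hB' y.1
    obtain ⟨l, hl⟩ := hC' y.2
    rw [MonoidHom.noncommCoprod_apply, hm, hk, hl]
    exact (hab.zpow_zpow m k).mul_right (hac.zpow_zpow m l)
  refine ⟨A.noncommCoprod (B.noncommCoprod C cBC) cA,
    ⟨(Multiplicative.ofAdd 1, 1, 1), ?_⟩, ⟨(1, Multiplicative.ofAdd 1, 1), ?_⟩,
    ⟨(1, 1, Multiplicative.ofAdd 1), ?_⟩⟩
  · simpa using hA 1
  · simpa using hB 1
  · simpa using hC 1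

theorem aux_iso {G H : Type*} [Group G] [Group H] [Finite H] (F : H →* G)
    (hF : F.range = ⊤) (hc : Nat.card H = Nat.card G) : Nonempty (G ≃* H) :=
  ⟨(MulEquiv.ofBijective F
    ((Nat.bijective_iff_surjective_and_card F).2 ⟨MonoidHom.range_eq_top.1 hF, hc⟩)).symm⟩

theorem aux_transport {G H : Type*} [Group G] [Group H] (p : ℕ) (e : H ≃* G)
    (h : ∃ x1 x2 x3 x4 : H, x1 * x2 * x3 * x4 = 1 ∧ orderOf x1 = 2 ∧ orderOf x2 = 2 ∧
        orderOf x3 = p ∧ orderOf x4 = 2 * p ∧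
        Subgroup.closure ({x1, x2, x3, x4} : Set H) = ⊤) :
    ∃ x1 x2 x3 x4 : G, x1 * x2 * x3 * x4 = 1 ∧ orderOf x1 = 2 ∧ orderOf x2 = 2 ∧
        orderOf x3 = p ∧ orderOf x4 = 2 * p ∧
        Subgroup.closure ({x1, x2, x3, x4} : Set G) = ⊤ := by
  obtain ⟨x1, x2, x3, x4, h0, h1, h2, h3, h4, h5⟩ := h
  refine ⟨e x1, e x2, e x3, e x4, ?_, ?_, ?_, ?_, ?_, ?_⟩
  · rw [← map_mul, ← map_mul, ← map_mul, h0, map_one]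
  · rw [e.orderOf_eq, h1]
  · rw [e.orderOf_eq, h2]
  · rw [e.orderOf_eq, h3]
  · rw [e.orderOf_eq, h4]
  · have := congrArg (Subgroup.map e.toMonoidHom) h5
    rw [MonoidHom.map_closure, Subgroup.map_top_of_surjective _ e.surjective] at this
    simpa [Set.image_insert_eq] using this

theorem aux_back_ab (p : ℕ) (hp : p.Prime) (hp5 : 5 ≤ p) :
    ∃ x1 x2 x3 x4 : Multiplicative (ZMod p) × Multiplicative (ZMod 2) × Multiplicative (ZMod 2),
        x1 * x2 * x3 * x4 = 1 ∧ orderOf x1 = 2 ∧ orderOf x2 = 2 ∧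
        orderOf x3 = p ∧ orderOf x4 = 2 * p ∧
        Subgroup.closure ({x1, x2, x3, x4} : Set _) = ⊤ := by
  have ho : ∀ n : ℕ, orderOf (Multiplicative.ofAdd (1 : ZMod n)) = n := fun n => by
    rw [orderOf_ofAdd_eq_addOrderOf, ZMod.addOrderOf_one]
  have hcop : Nat.Coprime p 2 :=
    (Nat.coprime_primes hp Nat.prime_two).2 (by omega)
  set a : Multiplicative (ZMod p) := Multiplicative.ofAdd 1 with ha
  set b : Multiplicative (ZMod 2) := Multiplicative.ofAdd 1 with hb
  have hbb : b * b = 1 := by decide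
  refine ⟨(1, b, 1), (1, 1, b), (a, 1, 1), (a⁻¹, b, b), ?_, ?_, ?_, ?_, ?_, ?_⟩
  · simp [hbb]
  · simp [Prod.orderOf, hb, ho]
  · simp [Prod.orderOf, hb, ho]
  · simp [Prod.orderOf, ha, ho]
  · rw [Prod.orderOf, Prod.orderOf]
    simp only [orderOf_inv, ha, hb, ho, Nat.lcm_self]
    rw [hcop.lcm_eq_mul, mul_comm]
  · rw [eq_top_iff]
    rintro ⟨x, y, z⟩ -
    have key : ∀ (n : ℕ) (x : Multiplicative (ZMod n)), ∃ k : ℤ,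
        x = (Multiplicative.ofAdd (1 : ZMod n)) ^ k := fun n x => by
      obtain ⟨k, hk⟩ := ZMod.intCast_surjective (Multiplicative.toAdd x)
      refine ⟨k, ?_⟩
      rw [← ofAdd_zsmul, zsmul_one, hk]; rfl
    obtain ⟨i, rfl⟩ := key p x
    obtain ⟨j, rfl⟩ := key 2 y
    obtain ⟨k, rfl⟩ := key 2 z
    have : (a ^ i, b ^ j, b ^ k) = ((a, 1, 1) : Multiplicative (ZMod p) × Multiplicative (ZMod 2) ×
        Multiplicative (ZMod 2)) ^ i * (1, b, 1) ^ j * (1, 1, b) ^ k := by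
      simp [Prod.pow_mk]
    rw [← ha, ← hb, this]
    refine mul_mem (mul_mem (zpow_mem (Subgroup.subset_closure ?_) _)
      (zpow_mem (Subgroup.subset_closure ?_) _)) (zpow_mem (Subgroup.subset_closure ?_) _) <;> simp

theorem aux_back_dih (p : ℕ) (hp : p.Prime) :
    ∃ x1 x2 x3 x4 : DihedralGroup (2 * p),
        x1 * x2 * x3 * x4 = 1 ∧ orderOf x1 = 2 ∧ orderOf x2 = 2 ∧
        orderOf x3 = p ∧ orderOf x4 = 2 * p ∧
        Subgroup.closure ({x1, x2, x3, x4} : Set _) = ⊤ := by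
  refine ⟨DihedralGroup.sr 0, DihedralGroup.sr (-3), DihedralGroup.r 1 ^ 2, DihedralGroup.r 1,
    ?_, DihedralGroup.orderOf_sr _, DihedralGroup.orderOf_sr _, ?_,
    DihedralGroup.orderOf_r_one, ?_⟩
  · rw [DihedralGroup.r_one_pow, DihedralGroup.sr_mul_sr, DihedralGroup.r_mul_r,
      DihedralGroup.r_mul_r, DihedralGroup.one_def]
    congr 1; push_cast; ring
  · rw [orderOf_pow_of_dvd two_ne_zero, DihedralGroup.orderOf_r_one]
    · simp
    · rw [DihedralGroup.orderOf_r_one]; exact dvd_mul_right _ _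
  · rw [eq_top_iff]
    have hr : ∀ i : ZMod (2 * p), DihedralGroup.r i ∈ Subgroup.closure
        ({DihedralGroup.sr 0, DihedralGroup.sr (-3), DihedralGroup.r 1 ^ 2,
          DihedralGroup.r 1} : Set (DihedralGroup (2 * p))) := fun i => by
      obtain ⟨k, rfl⟩ := ZMod.intCast_surjective i
      rw [← DihedralGroup.r_one_zpow]
      exact zpow_mem (Subgroup.subset_closure (by simp)) _
    rintro (i | i) -
    · exact hr i
    · have : DihedralGroup.sr i = DihedralGroup.sr 0 * DihedralGroup.r i := by simp
      rw [this]
      exact mul_mem (Subgroup.subset_closure (by simp)) (hr i)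

theorem aux_fwd (p : ℕ) (hp : p.Prime) (hp5 : 5 ≤ p)
    (G : Type*) [Group G] [Fintype G] (hcard : Fintype.card G = 4 * p)
    (x1 x2 x3 x4 : G) (h0 : x1 * x2 * x3 * x4 = 1) (h1 : orderOf x1 = 2)
    (h3 : orderOf x3 = p) (h4 : orderOf x4 = 2 * p)
    (h5 : Subgroup.closure ({x1, x2, x3, x4} : Set G) = ⊤) :
    (Nonempty (G ≃* Multiplicative (ZMod p) × Multiplicative (ZMod 2) × Multiplicative (ZMod 2)) ∨
        Nonempty (G ≃* DihedralGroup (2 * p))) := by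
  haveI : NeZero p := ⟨hp.ne_zero⟩
  haveI : NeZero (2 * p) := ⟨by omega⟩
  have hNc : Nat.card G = 4 * p := by rw [Nat.card_eq_fintype_card, hcard]
  obtain ⟨m, hm⟩ : Odd p := hp.odd_of_ne_two (by omega)
  have hidx : (Subgroup.zpowers x4).index = 2 := by
    have := (Subgroup.zpowers x4).card_mul_index
    rw [Nat.card_zpowers, h4, hNc] at this
    have hp0 : 0 < 2 * p := by omega
    apply Nat.eq_of_mul_eq_mul_left hp0
    rw [this]; ring
  have hx3 : x3 ∈ Subgroup.zpowers x4 := by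
    have e : x3 = (x3 ^ 2) ^ (m + 1) := by
      rw [← pow_mul, show 2 * (m + 1) = p + 1 by omega, pow_succ, ← h3, pow_orderOf_eq_one,
        one_mul]
    rw [e]
    exact pow_mem (Subgroup.sq_mem_of_index_two hidx x3) _
  -- any subgroup with x1, x4 is everything
  have hx2 : x2 = x1⁻¹ * x4⁻¹ * x3⁻¹ := by
    have : x2 = x1⁻¹ * (x1 * x2 * x3 * x4) * x4⁻¹ * x3⁻¹ := by group
    rw [h0] at this; simpa using this
  have htop : ∀ K : Subgroup G, x1 ∈ K → x4 ∈ K → K = ⊤ := by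
    intro K k1 k4
    have k3 : x3 ∈ K := (Subgroup.zpowers_le.2 k4) hx3
    have k2 : x2 ∈ K := by
      rw [hx2]; exact mul_mem (mul_mem (inv_mem k1) (inv_mem k4)) (inv_mem k3)
    rw [eq_top_iff, ← h5, Subgroup.closure_le]
    rintro y (rfl | rfl | rfl | rfl) <;> assumption
  have hx11 : x1 ^ 2 = 1 := by rw [← h1, pow_orderOf_eq_one]
  have hxm : x1 * x1 = 1 := by rw [← pow_two, hx11]
  have hx4p : x4 ^ (2 * p) = 1 := by rw [← h4, pow_orderOf_eq_one]
  have hN := Subgroup.normal_of_index_eq_two hidx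
  obtain ⟨k, hk⟩ := Subgroup.mem_zpowers_iff.1 (hN.conj_mem x4 (Subgroup.mem_zpowers x4) x1)
  have hkk : x4 ^ (k * k) = x4 ^ (1 : ℤ) := by
    rw [zpow_mul, hk, conj_zpow, hk, zpow_one]
    calc x1 * (x1 * x4 * x1⁻¹) * x1⁻¹ = (x1 * x1) * x4 * (x1 * x1)⁻¹ := by group
      _ = x4 := by rw [hxm]; simp
  have hdvd : ((2 * p : ℕ) : ℤ) ∣ k * k - 1 := by
    rw [← h4, orderOf_dvd_iff_zpow_eq_one, zpow_sub, hkk, mul_inv_cancel]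
  have hkodd : (2 : ℤ) ∣ k * k - 1 := dvd_trans (by push_cast; exact dvd_mul_right _ _) hdvd
  have hk2 : k % 2 = 1 := by
    rcases Int.emod_two_eq_zero_or_one k with h | h
    · exfalso
      obtain ⟨c, hc⟩ := Int.dvd_of_emod_eq_zero h
      obtain ⟨d, hd⟩ := hkodd
      rw [hc] at hd
      have : 2 * (2 * c * c - d) = 1 := by linarith
      omega
    · exact h
  have hcop : IsCoprime (2 : ℤ) (p : ℤ) := by
    have := Nat.isCoprime_iff_coprime.2 ((Nat.coprime_primes Nat.prime_two hp).2 (by omega))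
    exact_mod_cast this
  have hpd : (p : ℤ) ∣ (k - 1) * (k + 1) := by
    have : (k - 1) * (k + 1) = k * k - 1 := by ring
    rw [this]
    exact dvd_trans (by push_cast; exact dvd_mul_left _ _) hdvd
  rcases (Nat.prime_iff_prime_int.1 hp).dvd_or_dvd hpd with h | h
  · left
    have hd : ((2 * p : ℕ) : ℤ) ∣ k - 1 := by
      push_cast
      exact hcop.mul_dvd (by omega) h
    rw [← h4, orderOf_dvd_iff_zpow_eq_one, zpow_sub, zpow_one, mul_inv_eq_one, hk,
      mul_inv_eq_iff_eq_mul] at hd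
    have hc : Commute x4 x1 := hd.symm
    obtain ⟨F, ⟨ha, hb, hc⟩⟩ := aux_ab p (x4 ^ 2) (x4 ^ p) x1 (by rw [← pow_mul, hx4p])
      (by rw [← pow_mul, mul_comm, hx4p]) hx11 ((Commute.refl x4).pow_pow _ _)
      (hc.pow_left _) (hc.pow_left _)
    refine aux_iso F (htop _ hc ?_) ?_
    · have : x4 = x4 ^ p * ((x4 ^ 2) ^ m)⁻¹ := by
        rw [eq_mul_inv_iff_mul_eq, ← pow_mul, ← pow_succ', hm]
      rw [this]
      exact mul_mem hb (inv_mem (pow_mem ha _))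
    · rw [hNc, Nat.card_prod, Nat.card_prod]
      simp only [Nat.card_congr Multiplicative.toAdd, Nat.card_zmod]
      ring
  · right
    have hd : ((2 * p : ℕ) : ℤ) ∣ k + 1 := by
      push_cast
      exact hcop.mul_dvd (by omega) h
    rw [← h4, orderOf_dvd_iff_zpow_eq_one, zpow_add, zpow_one, mul_eq_one_iff_eq_inv, hk] at hd
    obtain ⟨F, hF1, hF2⟩ := aux_dih (2 * p) x4 x1 hx4p hxm hd
    refine aux_iso F (htop _ ⟨_, hF2⟩ ⟨_, hF1⟩) ?_
    rw [hNc, DihedralGroup.nat_card]; ring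

theorem stmt_12 (p : ℕ) (hp : p.Prime) (hp5 : 5 ≤ p)
    (G : Type*) [Group G] [Fintype G] (hcard : Fintype.card G = 4 * p) :
    (∃ x1 x2 x3 x4 : G, x1 * x2 * x3 * x4 = 1 ∧ orderOf x1 = 2 ∧ orderOf x2 = 2 ∧
        orderOf x3 = p ∧ orderOf x4 = 2 * p ∧
        Subgroup.closure ({x1, x2, x3, x4} : Set G) = ⊤) ↔
      (Nonempty (G ≃* Multiplicative (ZMod p) × Multiplicative (ZMod 2) × Multiplicative (ZMod 2)) ∨
        Nonempty (G ≃* DihedralGroup (2 * p))) := by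
  constructor
  · rintro ⟨x1, x2, x3, x4, h0, h1, -, h3, h4, h5⟩
    exact aux_fwd p hp hp5 G hcard x1 x2 x3 x4 h0 h1 h3 h4 h5
  · rintro (⟨⟨e⟩⟩ | ⟨⟨e⟩⟩)
    · exact aux_transport p e.symm (aux_back_ab p hp hp5)
    · exact aux_transport p e.symm (aux_back_dih p hp)
end

section
/- Let p ≥ 5 be a prime number and let G be a finite group of order 4p. Then there exist elements x, y, z ∈ G with x·y·z = 1, each of order 2p, and {x, y, z} generating G, if and only if G is isomorphic to Z_p × Z_2 × Z_2. -/
theorem aux_iso_s13 (p : ℕ) [NeZero p] (G : Type*) [CommGroup G] [Fintype G] (hcard : Fintype.card G = 4 * p)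
    (a u v : G) (ha : a ^ p = 1) (hu : u ^ 2 = 1) (hv : v ^ 2 = 1)
    (hcl : Subgroup.closure ({a, u, v} : Set G) = ⊤) :
    Nonempty (G ≃* Multiplicative (ZMod p) × Multiplicative (ZMod 2) × Multiplicative (ZMod 2)) := by
  have key : ∀ (n : ℕ) (g : G), g ^ n = 1 →
      ∃ f : Multiplicative (ZMod n) →* G, f (Multiplicative.ofAdd 1) = g := by
    intro n g hg
    let f : ZMod n →+ Additive G := ZMod.lift n ⟨zmultiplesHom (Additive G) (Additive.ofMul g), by
      simp only [zmultiplesHom_apply, natCast_zsmul, ← ofMul_pow, hg, ofMul_one]⟩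
    refine ⟨AddMonoidHom.toMultiplicativeLeft f, ?_⟩
    have h : f ((1 : ℤ) : ZMod n) = Additive.ofMul g := by
      simp only [f, ZMod.lift_coe]
      simp
    rw [Int.cast_one] at h
    change (f 1).toMul = g
    rw [h]; rfl
  obtain ⟨fa, hfa⟩ := key p a ha
  obtain ⟨fu, hfu⟩ := key 2 u hu
  obtain ⟨fv, hfv⟩ := key 2 v hv
  let F := fa.coprod (fu.coprod fv)
  have hs : Function.Surjective F := by
    rw [← MonoidHom.range_eq_top, eq_top_iff, ← hcl, Subgroup.closure_le]
    rintro g (rfl | rfl | rfl)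
    · exact ⟨(Multiplicative.ofAdd 1, 1, 1), by simp [F, hfa]⟩
    · exact ⟨(1, Multiplicative.ofAdd 1, 1), by simp [F, hfu]⟩
    · exact ⟨(1, 1, Multiplicative.ofAdd 1), by simp [F, hfv]⟩
  have hb : Function.Bijective F := by
    rw [Fintype.bijective_iff_surjective_and_card]
    refine ⟨hs, ?_⟩
    rw [hcard]
    simp [ZMod.card]
    ring
  exact ⟨(MulEquiv.ofBijective F hb).symm⟩

theorem aux_comm (m : ℕ) (G : Type*) [Group G] (x y : G)
    (hx : x ^ (2 * (2 * m + 1)) = 1) (hy : y ^ (2 * (2 * m + 1)) = 1)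
    (hxy : (x * y) ^ (2 * (2 * m + 1)) = 1)
    (cx : ∀ g, Commute (x ^ 2) g) (cy : ∀ g, Commute (y ^ 2) g)
    (cxy : ∀ g, Commute ((x * y) ^ 2) g) : x * y = y * x := by
  -- the commutator-like element
  have h1 : (x * y) ^ 2 = (y * x) ^ 2 := by
    have := cxy x
    have h : (x * y) ^ 2 * x = x * (y * x) ^ 2 := by simp only [pow_two, mul_assoc]
    rw [this.eq] at h
    exact mul_left_cancel h
  have h2 : (x * y) * (y * x) = x ^ 2 * y ^ 2 := by
    have := (cy x).eq
    calc (x * y) * (y * x) = x * (y ^ 2 * x) := by simp only [pow_two, mul_assoc]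
      _ = x ^ 2 * y ^ 2 := by rw [this]; simp only [pow_two, mul_assoc]
  have h3 : (y * x) * (x * y) = x ^ 2 * y ^ 2 := by
    have := (cx y).eq
    calc (y * x) * (x * y) = y * x ^ 2 * y := by simp only [pow_two, mul_assoc]
      _ = x ^ 2 * y ^ 2 := by rw [← this]; simp only [pow_two, mul_assoc]
  have hc : Commute (x * y) (y * x) := h2.trans h3.symm
  -- `w = (x y) (y x)⁻¹` has order dividing 2 and dividing the odd number
  have hyx : (y * x) ^ (2 * (2 * m + 1)) = 1 := by rw [pow_mul, ← h1, ← pow_mul, hxy]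
  have hw2 : ((x * y) * (y * x)⁻¹) ^ 2 = 1 := by
    rw [(hc.inv_right).mul_pow, h1, inv_pow, mul_inv_cancel]
  have hwo : ((x * y) * (y * x)⁻¹) ^ (2 * m + 1) = 1 := by
    have e : (x * y) * (y * x)⁻¹ = ((x * y) * (y * x)) * ((y * x) ^ 2)⁻¹ := by
      rw [pow_two, mul_inv_rev (y * x) (y * x), ← mul_assoc _ (y * x)⁻¹ (y * x)⁻¹,
        mul_inv_cancel_right]
    have c2 : Commute (x ^ 2 * y ^ 2) (((y * x) ^ 2)⁻¹) := ((cx _).mul_left (cy _))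
    rw [e, h2, c2.mul_pow, (cx _).mul_pow, ← pow_mul, ← pow_mul, hx, hy, inv_pow, ← pow_mul, hyx]
    simp
  rw [pow_succ, pow_mul, hw2, one_pow, one_mul] at hwo
  exact mul_inv_eq_one.mp hwo

theorem aux_fwd_s13 (p : ℕ) (hp : p.Prime) (hp5 : 5 ≤ p)
    (G : Type*) [Group G] [Fintype G] (hcard : Fintype.card G = 4 * p) (x y z : G)
    (hxyz : x * y * z = 1) (hx : orderOf x = 2 * p) (hy : orderOf y = 2 * p)
    (hz : orderOf z = 2 * p) (hcl : Subgroup.closure ({x, y, z} : Set G) = ⊤) :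
    Nonempty (G ≃* Multiplicative (ZMod p) × Multiplicative (ZMod 2) × Multiplicative (ZMod 2)) := by
  obtain ⟨m, hm⟩ : ∃ m, p = 2 * m + 1 := hp.odd_of_ne_two (by omega)
  have hzi : z = (x * y)⁻¹ := (inv_eq_of_mul_eq_one_right hxyz).symm
  have hind : ∀ g : G, orderOf g = 2 * p → (Subgroup.zpowers g).index = 2 := by
    intro g hg
    have := (Subgroup.zpowers g).card_mul_index
    rw [Nat.card_zpowers, hg, Nat.card_eq_fintype_card, hcard] at this
    have h : (2 * p) * (Subgroup.zpowers g).index = (2 * p) * 2 := by rw [this]; ring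
    exact Nat.eq_of_mul_eq_mul_left (by omega) h
  have hcl2 : Subgroup.closure ({x, y} : Set G) = ⊤ := by
    rw [eq_top_iff, ← hcl, Subgroup.closure_le]
    have h1 : x ∈ Subgroup.closure ({x, y} : Set G) := Subgroup.subset_closure (by simp)
    have h2 : y ∈ Subgroup.closure ({x, y} : Set G) := Subgroup.subset_closure (by simp)
    rintro g (rfl | rfl | rfl)
    · exact h1
    · exact h2
    · rw [hzi]; exact inv_mem (mul_mem h1 h2)
  have hsq : ∀ g h : G, orderOf g = 2 * p → Commute (h ^ 2) g := by
    intro g h hg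
    obtain ⟨k, hk⟩ := Subgroup.sq_mem_of_index_two (hind g hg) h
    simp only at hk
    rw [← hk]
    exact (Commute.refl g).zpow_left k
  have hcen : ∀ h g : G, Commute (h ^ 2) g := by
    intro h g
    have : Subgroup.closure ({x, y} : Set G) ≤ Subgroup.centralizer {h ^ 2} := by
      rw [Subgroup.closure_le]
      rintro g (rfl | rfl)
      · exact Subgroup.mem_centralizer_singleton_iff.2 (hsq _ h hx).eq.symm
      · exact Subgroup.mem_centralizer_singleton_iff.2 (hsq _ h hy).eq.symm
    rw [hcl2] at this
    exact (Subgroup.mem_centralizer_singleton_iff.1 (this (Subgroup.mem_top g))).symm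
  have hx1 : x ^ (2 * p) = 1 := hx ▸ pow_orderOf_eq_one x
  have hy1 : y ^ (2 * p) = 1 := hy ▸ pow_orderOf_eq_one y
  have hxy : x * y = y * x := by
    have hz1 : (x * y) ^ (2 * p) = 1 := by
      have : z ^ (2 * p) = 1 := hz ▸ pow_orderOf_eq_one z
      rwa [hzi, inv_pow, inv_eq_one] at this
    rw [hm] at hx1 hy1 hz1
    exact aux_comm m G x y hx1 hy1 hz1 (hcen x) (hcen y) (hcen (x * y))
  have hcomm : ∀ a b : G, a * b = b * a := by
    have h1 : ∀ c ∈ ({x, y} : Set G), ∀ g, Commute c g := by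
      intro c hc g
      have : Subgroup.closure ({x, y} : Set G) ≤ Subgroup.centralizer {c} := by
        rw [Subgroup.closure_le]
        intro g hg
        refine Subgroup.mem_centralizer_singleton_iff.2 ?_
        rcases hc with rfl | rfl <;> rcases hg with rfl | rfl <;> simp [hxy]
      rw [hcl2] at this
      exact (Subgroup.mem_centralizer_singleton_iff.1 (this (Subgroup.mem_top g))).symm
    intro a b
    have : Subgroup.closure ({x, y} : Set G) ≤ Subgroup.centralizer {a} := by
      rw [Subgroup.closure_le]
      intro g hg
      exact Subgroup.mem_centralizer_singleton_iff.2 (h1 g hg a).eq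
    rw [hcl2] at this
    exact (Subgroup.mem_centralizer_singleton_iff.1 (this (Subgroup.mem_top b))).symm
  haveI : NeZero p := ⟨hp.ne_zero⟩
  letI : CommGroup G := { ‹Group G› with mul_comm := hcomm }
  refine aux_iso_s13 p G hcard (x ^ 2) (x ^ p) (y ^ p) (by rw [← pow_mul, hx1])
    (by rw [← pow_mul, mul_comm, hx1]) (by rw [← pow_mul, mul_comm, hy1]) ?_
  rw [eq_top_iff, ← hcl2, Subgroup.closure_le]
  set K := Subgroup.closure ({x ^ 2, x ^ p, y ^ p} : Set G) with hK
  have ka : x ^ 2 ∈ K := Subgroup.subset_closure (by simp)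
  have ku : x ^ p ∈ K := Subgroup.subset_closure (by simp)
  have kv : y ^ p ∈ K := Subgroup.subset_closure (by simp)
  have kb : y ^ 2 ∈ K := by
    obtain ⟨k, hk⟩ := Subgroup.sq_mem_of_index_two (hind x hx) y
    simp only at hk
    have h1 : x ^ (k * p) = 1 := by
      rw [zpow_mul, hk, zpow_natCast, ← pow_mul, hy1]
    rw [← orderOf_dvd_iff_zpow_eq_one, hx] at h1
    push_cast at h1
    have h2 : (2 : ℤ) ∣ k :=
      Int.dvd_of_mul_dvd_mul_right (by exact_mod_cast hp.ne_zero) h1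
    obtain ⟨j, rfl⟩ := h2
    rw [← hk, zpow_mul]
    exact zpow_mem (by exact_mod_cast ka) j
  have last : ∀ g : G, g ^ 2 ∈ K → g ^ p ∈ K → g ∈ K := by
    intro g h2 h
    have : g = ((g ^ 2) ^ m)⁻¹ * g ^ p := by
      rw [hm, pow_succ g (2 * m), ← pow_mul, inv_mul_cancel_left]
    rw [this]
    exact mul_mem (inv_mem (pow_mem h2 m)) h
  rintro g (rfl | rfl)
  · exact last _ ka ku
  · exact last _ kb kv

theorem aux_bwd (p : ℕ) (hp : p.Prime) (hp5 : 5 ≤ p) :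
    ∃ x y z : Multiplicative (ZMod p) × Multiplicative (ZMod 2) × Multiplicative (ZMod 2),
      x * y * z = 1 ∧ orderOf x = 2 * p ∧ orderOf y = 2 * p ∧
        orderOf z = 2 * p ∧ Subgroup.closure {x, y, z} = ⊤ := by
  haveI : Fact p.Prime := ⟨hp⟩
  obtain ⟨m, hm⟩ : ∃ m, p = 2 * m + 1 := hp.odd_of_ne_two (by omega)
  let a : Multiplicative (ZMod p) := Multiplicative.ofAdd 1
  let b : Multiplicative (ZMod 2) := Multiplicative.ofAdd 1
  have oa : orderOf a = p := by simp [a, orderOf_ofAdd_eq_addOrderOf, ZMod.addOrderOf_one]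
  have ob : orderOf b = 2 := by simp [b, orderOf_ofAdd_eq_addOrderOf, ZMod.addOrderOf_one]
  have hap : a ^ p = 1 := orderOf_dvd_iff_pow_eq_one.1 oa.dvd
  have hb2 : b ^ 2 = 1 := orderOf_dvd_iff_pow_eq_one.1 ob.dvd
  have hcop : Nat.Coprime p 2 := by
    rw [hm]; simp
  have oa2 : orderOf ((a ^ 2)⁻¹) = p := by
    rw [orderOf_inv, Nat.Coprime.orderOf_pow, oa]
    rwa [oa]
  have hl : Nat.lcm p 2 = 2 * p := by rw [hcop.lcm_eq_mul, mul_comm]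
  have hbp : b ^ p = b := by rw [hm, pow_succ, pow_mul, hb2]; simp
  refine ⟨(a, b, 1), (a, 1, b), ((a ^ 2)⁻¹, b, b), ?_, ?_, ?_, ?_, ?_⟩
  · have : b * b = 1 := by rw [← pow_two, hb2]
    simp [Prod.ext_iff, this, pow_two]
  · simp [Prod.orderOf, oa, ob, hl]
  · simp [Prod.orderOf, oa, ob, hl]
  · simp [Prod.orderOf, oa2, ob, hl]
  · set K := Subgroup.closure {((a, b, 1) : Multiplicative (ZMod p) × Multiplicative (ZMod 2) × Multiplicative (ZMod 2)), (a, 1, b), ((a ^ 2)⁻¹, b, b)}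
    have k1 : (a, b, 1) ∈ K := Subgroup.subset_closure (by simp)
    have k2 : (a, 1, b) ∈ K := Subgroup.subset_closure (by simp)
    have l1 : (1, b, 1) ∈ K := by
      have := pow_mem k1 p
      simpa [hap, hbp] using this
    have l2 : (1, 1, b) ∈ K := by
      have := pow_mem k2 p
      simpa [hap, hbp] using this
    have l0 : (a, 1, 1) ∈ K := by
      have := mul_mem k1 (inv_mem l1)
      simpa using this
    have gen : ∀ (n : ℕ) [NeZero n] (c : Multiplicative (ZMod n)),
        ∃ k : ℕ, c = (Multiplicative.ofAdd (1 : ZMod n)) ^ k := by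
      intro n _ c
      refine ⟨(Multiplicative.toAdd c).val, ?_⟩
      rw [← ofAdd_nsmul]
      simp
    rw [eq_top_iff]
    rintro ⟨c, d, e⟩ -
    obtain ⟨i, rfl⟩ := gen p c
    obtain ⟨j, rfl⟩ := gen 2 d
    obtain ⟨k, rfl⟩ := gen 2 e
    have := mul_mem (mul_mem (pow_mem l0 i) (pow_mem l1 j)) (pow_mem l2 k)
    simpa [a, b] using this

theorem stmt_13 (p : ℕ) (hp : p.Prime) (hp5 : 5 ≤ p)
    (G : Type*) [Group G] [Fintype G] (hcard : Fintype.card G = 4 * p) :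
    (∃ x y z : G, x * y * z = 1 ∧ orderOf x = 2 * p ∧ orderOf y = 2 * p ∧
        orderOf z = 2 * p ∧ Subgroup.closure ({x, y, z} : Set G) = ⊤) ↔
      Nonempty (G ≃* Multiplicative (ZMod p) × Multiplicative (ZMod 2) × Multiplicative (ZMod 2)) := by
  constructor
  · rintro ⟨x, y, z, h, hx, hy, hz, hcl⟩
    exact aux_fwd_s13 p hp hp5 G hcard x y z h hx hy hz hcl
  · rintro ⟨e⟩
    obtain ⟨x, y, z, h, hx, hy, hz, hcl⟩ := aux_bwd p hp hp5
    refine ⟨e.symm x, e.symm y, e.symm z, ?_, ?_, ?_, ?_, ?_⟩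
    · rw [← map_mul, ← map_mul, h, map_one]
    · rw [MulEquiv.orderOf_eq, hx]
    · rw [MulEquiv.orderOf_eq, hy]
    · rw [MulEquiv.orderOf_eq, hz]
    · have := congrArg (Subgroup.map e.symm.toMonoidHom) hcl
      rw [MonoidHom.map_closure, Subgroup.map_top_of_surjective _ e.symm.surjective] at this
      simpa [Set.image_insert_eq] using this
end

section
/- Let p ≥ 5 be a prime number and let G be a finite group of order 4p. Then there exist elements x, y, z ∈ G with x·y·z = 1, orderOf x = p, orderOf y = 4p, orderOf z = 4p, and {x, y, z} generating G, if and only if G is cyclic. -/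
theorem stmt_14 (p : ℕ) (hp : p.Prime) (hp5 : 5 ≤ p)
    (G : Type*) [Group G] [Fintype G] (hcard : Fintype.card G = 4 * p) :
    (∃ x y z : G, x * y * z = 1 ∧ orderOf x = p ∧ orderOf y = 4 * p ∧
        orderOf z = 4 * p ∧ Subgroup.closure ({x, y, z} : Set G) = ⊤) ↔
      IsCyclic G := by
  constructor
  · rintro ⟨x, y, z, -, -, hy, -, -⟩
    exact isCyclic_of_orderOf_eq_card y (by rw [Nat.card_eq_fintype_card, hcard, hy])
  · intro h
    obtain ⟨g, hg⟩ := h.exists_generator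
    have ho : orderOf g = 4 * p := by
      rw [orderOf_eq_card_of_forall_mem_zpowers hg, Nat.card_eq_fintype_card, hcard]
    refine ⟨g ^ 4, g⁻¹, (g ^ 3)⁻¹, by group, ?_, ?_, ?_, ?_⟩
    · rw [orderOf_pow_of_dvd (by norm_num) (by rw [ho]; exact dvd_mul_right 4 p), ho]
      omega
    · rw [orderOf_inv, ho]
    · rw [orderOf_inv, Nat.Coprime.orderOf_pow, ho]
      rw [ho]
      refine Nat.Coprime.mul_left (by norm_num) ?_
      exact (Nat.coprime_primes hp Nat.prime_three).2 (by omega)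
    · rw [eq_top_iff]
      intro a _
      have hm : g ∈ Subgroup.closure ({g ^ 4, g⁻¹, (g ^ 3)⁻¹} : Set G) := by
        rw [← inv_mem_iff]
        exact Subgroup.subset_closure (by simp)
      exact (Subgroup.zpowers_le.2 hm) (hg a)
end

section
/- Let p ≥ 5 be a prime number and let S = {x ∈ Z/pZ : x ≠ 0 and x ≠ −1}. Consider the equivalence relation on S generated by relating each x to x⁻¹ and each x to −(1+x)⁻¹ (both of which again lie in S). Then the number of equivalence classes is (p+5)/6 if p ≡ 1 (mod 3), and (p+1)/6 if p ≡ 2 (mod 3). -/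
/-- The set S = {x ∈ ℤ/pℤ : x ≠ 0, x ≠ -1}. -/
def stmtS (p : ℕ) : Type := {x : ZMod p // x ≠ 0 ∧ x ≠ -1}

/-- The base relation on S relating each x to x⁻¹ and to -(1+x)⁻¹;
the generated equivalence relation is the equality of the quotient `Quot (stmtR p)`. -/
def stmtR (p : ℕ) (a b : stmtS p) : Prop :=
  b.val = (a.val)⁻¹ ∨ b.val = -(1 + a.val)⁻¹

/-- The explicit orbit of `x`. -/
def orb (p : ℕ) [Fact p.Prime] (x : ZMod p) : Finset (ZMod p) :=
  {x, x⁻¹, -1 - x, -(1 + x)⁻¹, -1 - x⁻¹, -1 + (1 + x)⁻¹}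

theorem orb_ind (p : ℕ) [Fact p.Prime] (P : ZMod p → Prop)
    (h1 : ∀ x, x ≠ 0 → x ≠ -1 → P x → P x⁻¹)
    (h2 : ∀ x, x ≠ 0 → x ≠ -1 → P x → P (-(1 + x)⁻¹))
    (x : ZMod p) (hx : x ≠ 0) (hx1 : x ≠ -1) (hP : P x) : ∀ y ∈ orb p x, P y := by
  have e : 1 + x ≠ 0 := by grind
  have a1 := h1 x hx hx1 hP
  have a2 := h2 x hx hx1 hP
  have e3 : (-(1 + x)⁻¹)⁻¹ = -1 - x := by grind
  have e4 : -(1 + -(1 + x)⁻¹)⁻¹ = -1 - x⁻¹ := by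
    have : 1 + -(1 + x)⁻¹ = x * (1 + x)⁻¹ := by grind
    rw [this, mul_inv, inv_inv]; grind
  have e5 : (-1 - x⁻¹)⁻¹ = -1 + (1 + x)⁻¹ := by
    have : -1 - x⁻¹ = -(x⁻¹ * (1 + x)) := by grind
    rw [this, inv_neg, mul_inv, inv_inv]; grind
  have n0 : -(1 + x)⁻¹ ≠ 0 := neg_ne_zero.2 (inv_ne_zero e)
  have n1 : -(1 + x)⁻¹ ≠ -1 := by
    intro h
    have h' : 1 + x = 1 := inv_eq_one.1 (neg_injective h)
    exact hx (by simpa using h')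
  have n2 : -1 - x⁻¹ ≠ -1 := by simpa using hx
  have n3 : -1 - x⁻¹ ≠ 0 := by
    intro h
    have h' : x⁻¹ = -1 := (sub_eq_zero.1 h).symm
    rw [inv_eq_iff_eq_inv, inv_neg, inv_one] at h'
    exact hx1 h'
  have a3 := h1 _ n0 n1 a2
  have a4 := h2 _ n0 n1 a2
  rw [e3] at a3
  rw [e4] at a4
  have a5 := h1 _ n3 n2 a4
  rw [e5] at a5
  intro y hy
  simp only [orb, Finset.mem_insert, Finset.mem_singleton] at hy
  rcases hy with h | h | h | h | h | h <;> rw [h] <;> assumption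

theorem orb_inv (p : ℕ) [Fact p.Prime] (x : ZMod p) (hx : x ≠ 0) (hx1 : x ≠ -1) :
    orb p x⁻¹ = orb p x := by
  have e : 1 + x ≠ 0 := by grind
  have e1 : (1 + x⁻¹)⁻¹ = 1 - (1 + x)⁻¹ := by
    have : 1 + x⁻¹ = x⁻¹ * (1 + x) := by grind
    rw [this, mul_inv, inv_inv]; grind
  ext y
  simp only [orb, Finset.mem_insert, Finset.mem_singleton, e1, inv_inv]
  grind

theorem orb_v (p : ℕ) [Fact p.Prime] (x : ZMod p) (hx : x ≠ 0) (hx1 : x ≠ -1) :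
    orb p (-(1 + x)⁻¹) = orb p x := by
  have e : 1 + x ≠ 0 := by grind
  have e1 : (1 + -(1 + x)⁻¹)⁻¹ = 1 + x⁻¹ := by
    have : 1 + -(1 + x)⁻¹ = x * (1 + x)⁻¹ := by grind
    rw [this, mul_inv, inv_inv]; grind
  ext y
  simp only [orb, Finset.mem_insert, Finset.mem_singleton, e1, inv_inv, inv_neg]
  grind

theorem orb_mem (p : ℕ) [Fact p.Prime] (x : ZMod p) (hx : x ≠ 0) (hx1 : x ≠ -1) :
    ∀ y ∈ orb p x, (y ≠ 0 ∧ y ≠ -1) ∧ orb p y = orb p x := by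
  apply orb_ind p (fun y => (y ≠ 0 ∧ y ≠ -1) ∧ orb p y = orb p x) _ _ x hx hx1 ⟨⟨hx, hx1⟩, rfl⟩
  · rintro z h0 h1 ⟨_, h⟩
    exact ⟨⟨by grind, by grind⟩, by rw [orb_inv p z h0 h1, h]⟩
  · rintro z h0 h1 ⟨_, h⟩
    have : 1 + z ≠ 0 := by grind
    exact ⟨⟨by grind, by grind⟩, by rw [orb_v p z h0 h1, h]⟩

theorem orb_quot (p : ℕ) [Fact p.Prime] (x : stmtS p) (y : stmtS p) (h : y.1 ∈ orb p x.1) :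
    Quot.mk (stmtR p) y = Quot.mk (stmtR p) x := by
  have := orb_ind p (fun y => ∃ h : y ≠ 0 ∧ y ≠ -1,
    Quot.mk (stmtR p) ⟨y, h⟩ = Quot.mk (stmtR p) x) ?_ ?_ x.1 x.2.1 x.2.2 ⟨x.2, rfl⟩ y.1 h
  · exact this.2
  · rintro z h0 h1 ⟨h, hq⟩
    refine ⟨⟨by grind, by grind⟩, ?_⟩
    rw [← hq]
    symm; apply Quot.sound; exact Or.inl rfl
  · rintro z h0 h1 ⟨h, hq⟩
    have : 1 + z ≠ 0 := by grind
    refine ⟨⟨by grind, by grind⟩, ?_⟩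
    rw [← hq]
    symm; apply Quot.sound; exact Or.inr rfl

theorem self_mem_orb (p : ℕ) [Fact p.Prime] (x : ZMod p) : x ∈ orb p x := by simp [orb]

/-- S as a finset. -/
def TT (p : ℕ) [Fact p.Prime] : Finset (ZMod p) := {x | x ≠ 0 ∧ x ≠ -1}

theorem mem_TT (p : ℕ) [Fact p.Prime] (x : ZMod p) : x ∈ TT p ↔ x ≠ 0 ∧ x ≠ -1 := by simp [TT]

theorem card_TT (p : ℕ) [Fact p.Prime] (hp5 : 5 ≤ p) : (TT p).card + 2 = p := by
  have h : TT p = Finset.univ \ {0, -1} := by ext; simp [TT]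
  have h2 : ({0, -1} : Finset (ZMod p)).card = 2 := Finset.card_pair (by simp)
  rw [h, Finset.card_sdiff_of_subset (Finset.subset_univ _), h2, Finset.card_univ, ZMod.card]
  omega

theorem card_quot (p : ℕ) [Fact p.Prime] :
    Nat.card (Quot (stmtR p)) = ((TT p).image (orb p)).card := by
  rw [← Nat.card_eq_finsetCard]
  have key : ∀ a b, stmtR p a b → orb p a.1 = orb p b.1 := by
    rintro a b (h | h)
    · rw [h, orb_inv p a.1 a.2.1 a.2.2]
    · rw [h, orb_v p a.1 a.2.1 a.2.2]
  let g : Quot (stmtR p) → Finset (ZMod p) := Quot.lift (fun a => orb p a.1) key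
  have hg : ∀ q, g q ∈ (TT p).image (orb p) := by
    rintro ⟨a⟩
    exact Finset.mem_image_of_mem _ ((mem_TT p a.1).2 a.2)
  refine Nat.card_eq_of_bijective (fun q => ⟨g q, hg q⟩) ⟨?_, ?_⟩
  · rintro ⟨a⟩ ⟨b⟩ h
    have h' : orb p a.1 = orb p b.1 := congrArg Subtype.val h
    exact orb_quot p b a (h' ▸ self_mem_orb p a.1)
  · rintro ⟨O, hO⟩
    obtain ⟨x, hx, rfl⟩ := Finset.mem_image.1 hO
    exact ⟨Quot.mk _ ⟨x, (mem_TT p x).1 hx⟩, rfl⟩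

theorem sum_orb (p : ℕ) [Fact p.Prime] :
    ∑ O ∈ (TT p).image (orb p), O.card = (TT p).card := by
  rw [Finset.card_eq_sum_card_image (orb p) (TT p)]
  refine Finset.sum_congr rfl fun O hO => ?_
  obtain ⟨x, hx, rfl⟩ := Finset.mem_image.1 hO
  rw [mem_TT] at hx
  congr 1
  ext y
  rw [Finset.mem_filter, mem_TT]
  constructor
  · exact orb_mem p x hx.1 hx.2 y
  · rintro ⟨_, h⟩
    rw [← h]; exact self_mem_orb p y

theorem card_orb (p : ℕ) [Fact p.Prime] (x : ZMod p) (hx : x ≠ 0 ∧ x ≠ -1)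
    (h1 : x ≠ 1) (h2 : x ≠ -2) (h3 : 2 * x + 1 ≠ 0) (h4 : x ^ 2 + x + 1 ≠ 0) :
    (orb p x).card = 6 := by
  obtain ⟨hx0, hx1⟩ := hx
  have e : 1 + x ≠ 0 := by grind
  unfold orb
  repeat rw [Finset.card_insert_of_notMem]
  · simp
  all_goals
    simp only [Finset.mem_insert, Finset.mem_singleton]
    grind

theorem two_three (p : ℕ) [Fact p.Prime] (hp5 : 5 ≤ p) : (2 : ZMod p) ≠ 0 ∧ (3 : ZMod p) ≠ 0 := by
  constructor
  · intro h
    have : ((2 : ℕ) : ZMod p) = 0 := by exact_mod_cast h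
    rw [ZMod.natCast_eq_zero_iff] at this
    have := Nat.le_of_dvd (by norm_num) this
    omega
  · intro h
    have : ((3 : ℕ) : ZMod p) = 0 := by exact_mod_cast h
    rw [ZMod.natCast_eq_zero_iff] at this
    have := Nat.le_of_dvd (by norm_num) this
    omega

theorem orb_one (p : ℕ) [Fact p.Prime] (hp5 : 5 ≤ p) : (orb p 1).card = 3 := by
  obtain ⟨h2, h3⟩ := two_three p hp5
  have : orb p 1 = {1, -2, -2⁻¹} := by
    have e : (1 + 1 : ZMod p) = 2 := by norm_num
    ext y
    simp only [orb, Finset.mem_insert, Finset.mem_singleton, e, inv_one]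
    grind
  rw [this]
  repeat rw [Finset.card_insert_of_notMem]
  · simp
  all_goals
    simp only [Finset.mem_insert, Finset.mem_singleton]
    grind

theorem orb_omega (p : ℕ) [Fact p.Prime] (hp5 : 5 ≤ p) (x : ZMod p) (h : x ^ 2 + x + 1 = 0) :
    orb p x = {x, -1 - x} := by
  have hx : x ≠ 0 := by grind
  have e : 1 + x ≠ 0 := by grind
  ext y
  simp only [orb, Finset.mem_insert, Finset.mem_singleton]
  have e1 : x⁻¹ = -1 - x := by grind
  have e2 : (1 + x)⁻¹ = - x := by grind
  rw [e1, e2]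
  grind

theorem orb_omega_card (p : ℕ) [Fact p.Prime] (hp5 : 5 ≤ p) (x : ZMod p)
    (h : x ^ 2 + x + 1 = 0) : (orb p x).card = 2 := by
  obtain ⟨h2, h3⟩ := two_three p hp5
  rw [orb_omega p hp5 x h]
  apply Finset.card_pair
  grind

theorem omega_exists (p : ℕ) [hp : Fact p.Prime] (h : p % 3 = 1) :
    ∃ x : ZMod p, x ^ 2 + x + 1 = 0 := by
  have : Fact (Nat.Prime 3) := ⟨by norm_num⟩
  obtain ⟨u, hu⟩ := exists_prime_orderOf_dvd_card (G := (ZMod p)ˣ) 3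
    (by rw [ZMod.card_units]; omega)
  have h3 : u ^ 3 = 1 := by rw [← hu]; exact pow_orderOf_eq_one u
  have h1 : u ≠ 1 := by rintro rfl; simp at hu
  have h3' : (u : ZMod p) ^ 3 = 1 := by rw [← Units.val_pow_eq_pow_val, h3, Units.val_one]
  have h1' : (u : ZMod p) ≠ 1 := by simpa using h1
  refine ⟨u, ?_⟩
  grind

theorem omega_not (p : ℕ) [hp : Fact p.Prime] (hp5 : 5 ≤ p) (h : p % 3 = 2) (x : ZMod p) :
    x ^ 2 + x + 1 ≠ 0 := by
  intro hx
  obtain ⟨h2, h3⟩ := two_three p hp5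
  have : Fact (Nat.Prime 3) := ⟨by norm_num⟩
  have ho : orderOf x = 3 := orderOf_eq_prime (by grind) (by grind)
  have := ZMod.orderOf_dvd_card_sub_one (p := p) (a := x) (by grind)
  rw [ho] at this
  omega

theorem orb_three (p : ℕ) [Fact p.Prime] (hp5 : 5 ≤ p) (x : ZMod p)
    (h : x = 1 ∨ x = -2 ∨ 2 * x + 1 = 0) : orb p x = orb p 1 := by
  obtain ⟨h2, h3⟩ := two_three p hp5
  refine (orb_mem p 1 (by grind) (by grind) x ?_).2
  have e : (1 + 1 : ZMod p) = 2 := by norm_num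
  simp only [orb, Finset.mem_insert, Finset.mem_singleton, e]
  grind

theorem stmt_15 (p : ℕ) (hp : p.Prime) (hp5 : 5 ≤ p) :
    (p % 3 = 1 → Nat.card (Quot (stmtR p)) = (p + 5) / 6) ∧
      (p % 3 = 2 → Nat.card (Quot (stmtR p)) = (p + 1) / 6) := by
  haveI : Fact p.Prime := ⟨hp⟩
  obtain ⟨h2, h3⟩ := two_three p hp5
  rw [card_quot]
  have hs := sum_orb p
  have hT := card_TT p hp5
  have hA : orb p 1 ∈ (TT p).image (orb p) :=
    Finset.mem_image_of_mem _ ((mem_TT p 1).2 ⟨by grind, by grind⟩)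
  rw [← Finset.add_sum_erase _ _ hA, orb_one p hp5] at hs
  have hc := Finset.card_erase_add_one hA
  constructor
  · intro h
    obtain ⟨w, hw⟩ := omega_exists p h
    have hB : orb p w ∈ ((TT p).image (orb p)).erase (orb p 1) := by
      refine Finset.mem_erase.2 ⟨?_, Finset.mem_image_of_mem _ ((mem_TT p w).2 ⟨by grind, by grind⟩)⟩
      intro h
      have a := orb_one p hp5
      rw [← h, orb_omega_card p hp5 w hw] at a
      omega
    rw [← Finset.add_sum_erase _ _ hB, orb_omega_card p hp5 w hw] at hs
    have hc' := Finset.card_erase_add_one hB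
    rw [Finset.sum_const_nat (m := 6)] at hs
    · omega
    intro O hO
    rw [Finset.mem_erase, Finset.mem_erase] at hO
    obtain ⟨n1, n2, hO⟩ := hO
    obtain ⟨x, hx, rfl⟩ := Finset.mem_image.1 hO
    rw [mem_TT] at hx
    have := mt (orb_three p hp5 x) n2
    refine card_orb p x hx (by tauto) (by tauto) (by tauto) fun h4 => n1 ?_
    refine (orb_mem p w (by grind) (by grind) x ?_).2
    rw [orb_omega p hp5 w hw, Finset.mem_insert, Finset.mem_singleton]
    grind
  · intro h
    rw [Finset.sum_const_nat (m := 6)] at hs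
    · omega
    intro O hO
    rw [Finset.mem_erase] at hO
    obtain ⟨n2, hO⟩ := hO
    obtain ⟨x, hx, rfl⟩ := Finset.mem_image.1 hO
    rw [mem_TT] at hx
    have := mt (orb_three p hp5 x) n2
    exact card_orb p x hx (by tauto) (by tauto) (by tauto) (omega_not p hp5 h x)
end

section
/- Let p ≥ 11 be a prime number and let λ ≥ 4 be an integer. Then there is no positive integer k with k·((λ−4)·p + 6) = 4·p·λ. -/
theorem stmt_16 (p : ℕ) (hp : p.Prime) (hp11 : 11 ≤ p)
    (lam : ℕ) (hlam : 4 ≤ lam) :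
    ¬ ∃ k : ℕ, 0 < k ∧ k * ((lam - 4) * p + 6) = 4 * p * lam := by
  rintro ⟨k, hk, h⟩
  obtain ⟨m, rfl⟩ := Nat.exists_eq_add_of_le hlam
  rw [Nat.add_sub_cancel_left] at h
  have h6 : p ∣ k * 6 := by
    have h1 : p ∣ k * m * p + k * 6 := ⟨4 * (4 + m), by linarith⟩
    exact (Nat.dvd_add_right (Dvd.intro_left _ rfl)).1 h1
  have hpk : p ∣ k := by
    rcases hp.dvd_mul.1 h6 with h1 | h1
    · exact h1
    · have := Nat.le_of_dvd (by norm_num) h1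
      omega
  obtain ⟨j, rfl⟩ := hpk
  have hj : 0 < j := Nat.pos_of_mul_pos_left hk
  have e : j * (m * p + 6) = 4 * (4 + m) := by
    apply Nat.eq_of_mul_eq_mul_left hp.pos
    linarith
  have hle : m * p + 6 ≤ 4 * (4 + m) := by
    rw [← e]; exact Nat.le_mul_of_pos_left _ hj
  have hm : m * 11 ≤ m * p := Nat.mul_le_mul_left m hp11
  have hm1 : m = 0 ∨ m = 1 := by omega
  rcases hm1 with rfl | rfl
  · omega
  · have hj1 : j = 1 := by nlinarith
    subst hj1
    have : p = 14 := by omega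
    subst this
    norm_num at hp
end

section
/- Let p ≥ 11 be a prime number and let λ ≥ 3 be an integer. Then there is no positive integer k with k·((λ−2)·p + 3) = 6·p·λ. -/
theorem stmt_17 (p : ℕ) (hp : p.Prime) (hp11 : 11 ≤ p)
    (lam : ℕ) (hlam : 3 ≤ lam) :
    ¬ ∃ k : ℕ, 0 < k ∧ k * ((lam - 2) * p + 3) = 6 * p * lam := by
  rintro ⟨k, hk, h⟩
  obtain ⟨n, rfl⟩ : ∃ n, lam = n + 2 := ⟨lam - 2, by omega⟩
  rw [Nat.add_sub_cancel] at h
  have hn : 1 ≤ n := by omega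
  have hdvd : p ∣ k * (n * p + 3) := by
    rw [h]
    exact ⟨6 * (n + 2), by ring⟩
  have hpk : p ∣ k := by
    rcases (Nat.Prime.dvd_mul hp).1 hdvd with h1 | h1
    · exact h1
    · have h3 : p ∣ 3 := (Nat.dvd_add_right (Dvd.intro_left n rfl)).1 h1
      have := Nat.le_of_dvd (by norm_num) h3
      omega
  obtain ⟨m, rfl⟩ := hpk
  have hm : 0 < m := Nat.pos_of_mul_pos_left hk
  have h2 : m * (n * p + 3) = 6 * (n + 2) :=
    Nat.eq_of_mul_eq_mul_left hp.pos (by linarith)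
  have h3 : n * 11 ≤ n * p := Nat.mul_le_mul_left n hp11
  have h4 : 1 * (n * p + 3) ≤ m * (n * p + 3) := Nat.mul_le_mul_right _ hm
  have hn1 : n = 1 := by omega
  subst hn1
  have hm1 : m = 1 := by
    by_contra hne
    have : 2 * (1 * p + 3) ≤ m * (1 * p + 3) := Nat.mul_le_mul_right _ (by omega)
    omega
  subst hm1
  have : p = 15 := by omega
  subst this
  norm_num at hp
end

section
/- Let p be a prime number and let φ be an injective homomorphism from the cyclic group Z_4 of order 4 to the automorphism group of the cyclic group Z_p of order p. Then the semidirect product Z_p ⋊_φ Z_4 contains no element of order 2p. -/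
theorem aux_fix (p : ℕ) (hp : p.Prime) (f : MulAut (Multiplicative (ZMod p)))
    (a : Multiplicative (ZMod p)) (ha : a ≠ 1) (h : f a = a) : f = 1 := by
  have := Fact.mk hp
  ext1 x
  have hc : Nat.card (Multiplicative (ZMod p)) = p := by simp
  obtain ⟨n, rfl⟩ := Subgroup.mem_zpowers_iff.1 (mem_zpowers_of_prime_card hc ha (g' := x))
  simp [map_zpow, h]

theorem stmt_19 (p : ℕ) (hp : p.Prime)
    (φ : Multiplicative (ZMod 4) →* MulAut (Multiplicative (ZMod p)))
    (hφ : Function.Injective φ)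
    (g : Multiplicative (ZMod p) ⋊[φ] Multiplicative (ZMod 4)) :
    orderOf g ≠ 2 * p := by
  intro hg
  have hpc : ∀ x : Multiplicative (ZMod p), x ^ p = 1 := fun x => by
    have := pow_card_eq_one' (x := x)
    have hc : Nat.card (Multiplicative (ZMod p)) = p := Nat.card_zmod p
    rwa [hc] at this
  have h4 : ∀ x : Multiplicative (ZMod 4), x ^ 4 = 1 := by decide
  have h2p : g ^ (2 * p) = 1 := hg ▸ pow_orderOf_eq_one g
  have hp1 := hp.one_lt
  rcases hp.eq_two_or_odd' with rfl | hodd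
  · have key : φ (Multiplicative.ofAdd 1) = 1 := by
      have ha : (Multiplicative.ofAdd (1 : ZMod 2)) ≠ 1 := by decide
      apply aux_fix 2 hp _ _ ha
      have hd : ∀ x : Multiplicative (ZMod 2), x ≠ 1 → x = Multiplicative.ofAdd 1 := by decide
      apply hd
      intro h
      exact ha ((map_eq_one_iff _ (MulEquiv.injective _)).1 h)
    have := (map_eq_one_iff φ hφ).1 key
    exact absurd this (by decide)
  · have hcop : Nat.Coprime p 4 := by
      have : Nat.Coprime p (2 ^ 2) := Nat.Coprime.pow_right 2 hodd.coprime_two_right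
      simpa using this
    have hr : (g ^ 2).right = 1 := by
      have e1 : (g ^ 2).right ^ p = 1 := by
        have := congrArg (SemidirectProduct.rightHom (φ := φ)) h2p
        rw [pow_mul, map_pow] at this
        simpa using this
      have := Nat.dvd_gcd (orderOf_dvd_of_pow_eq_one e1) (orderOf_dvd_of_pow_eq_one (h4 _))
      rw [hcop.gcd_eq_one] at this
      exact orderOf_eq_one_iff.1 (Nat.dvd_one.1 this)
    have hl : (g ^ 2).left ≠ 1 := by
      intro h
      have : g ^ 2 = 1 := SemidirectProduct.ext h hr
      have := Nat.le_of_dvd (by norm_num) (orderOf_dvd_of_pow_eq_one this)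
      omega
    have hcomm : g ^ p * g ^ 2 = g ^ 2 * g ^ p := by rw [← pow_add, ← pow_add, add_comm]
    have hfix : φ (g ^ p).right (g ^ 2).left = (g ^ 2).left := by
      have := congrArg SemidirectProduct.left hcomm
      rw [SemidirectProduct.mul_left, SemidirectProduct.mul_left, hr, map_one, MulAut.one_apply,
        mul_comm] at this
      exact mul_right_cancel this
    have hk : (g ^ p).right = 1 := (map_eq_one_iff φ hφ).1 (aux_fix p hp _ _ hl hfix)
    have hk' : g ^ p = SemidirectProduct.inl (g ^ p).left := by
      apply SemidirectProduct.ext <;> simp [hk]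
    have hpp : g ^ (p * p) = 1 := by
      rw [pow_mul, hk', ← map_pow, hpc, map_one]
    have hd := orderOf_dvd_of_pow_eq_one hpp
    rw [hg] at hd
    have h2 : 2 ∣ p * p := (Dvd.intro _ rfl).trans hd
    have := (hodd.mul hodd)
    exact (Nat.not_even_iff_odd.2 this) (even_iff_two_dvd.2 h2)
end
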